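/- arXiv:1901.01071 — 9 statements merged into one kernel-verified Lean document; each statement's English description precedes it below -/
import Mathlib

section
/- Let r ≥ 0 and n ≥ 1 be integers and p a prime. If p divides n and p divides the binomial coefficient C(n+r, r), then p^{ν_p(n)} ≤ r. -/
theorem prime_pow_padicValNat_le_of_dvd_choose (n r : ℕ) (hn : 1 ≤ n) (p : ℕ) (hp : p.Prime)
    (hpn : p ∣ n) (hpc : p ∣ (n + r).choose r) :
    p ^ padicValNat p n ≤ r := by
  have : Fact p.Prime := ⟨hp⟩
  have hdvd : p ^ padicValNat p n ∣ n := pow_padicValNat_dvd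
  set a := padicValNat p n
  by_contra! hr
  have hval := one_le_padicValNat_of_dvd (Nat.choose_ne_zero (Nat.le_add_left r n)) hpc
  rw [padicValNat_choose' (Nat.lt_succ_self _)] at hval
  obtain ⟨i, hi⟩ := Finset.card_pos.mp hval
  have hcarry := (Finset.mem_filter.mp hi).2
  have hpi : 0 < p ^ i := pow_pos hp.pos i
  have hrlt := Nat.mod_lt r hpi
  have hnlt := Nat.mod_lt n hpi
  obtain hia | hai := le_total i a
  · rw [Nat.mod_eq_zero_of_dvd ((pow_dvd_pow p hia).trans hdvd)] at hcarry
    omega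
  · have hpai : p ^ a ∣ p ^ i := pow_dvd_pow p hai
    have hgap : p ^ a ∣ p ^ i - n % p ^ i :=
      Nat.dvd_sub hpai ((Nat.dvd_mod_iff hpai).mpr hdvd)
    have hle := Nat.le_of_dvd (Nat.sub_pos_of_lt hnlt) hgap
    have := Nat.mod_le r (p ^ i)
    omega
end

section
/- Let r ≥ 0 and n ≥ 1 be integers and p a prime with p | n, p | C(n+r, r) and r < p². Then ⌊r/p⌋ ≥ 1, and there exists an integer j with 1 ≤ j ≤ ⌊r/p⌋ such that n/p ≡ −j (mod p). -/
/-- If a prime `p` divides both `n` and `(n + r).choose r`, then it divides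
`(n / p + r / p).choose (r / p)`, by Lucas' theorem. -/
theorem Nat.Prime.dvd_choose_div {p : ℕ} (hp : p.Prime) {n r : ℕ} (hpn : p ∣ n)
    (hpc : p ∣ (n + r).choose r) : p ∣ (n / p + r / p).choose (r / p) := by
  have : Fact p.Prime := ⟨hp⟩
  obtain ⟨m, rfl⟩ := hpn
  have h := (Choose.choose_modEq_choose_mod_mul_choose_div_nat (p := p)
    (n := p * m + r) (k := r)).dvd_iff dvd_rfl |>.mp hpc
  rw [Nat.mul_add_mod, Nat.choose_self, one_mul, Nat.mul_add_div hp.pos] at h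
  rwa [Nat.mul_div_cancel_left m hp.pos]

/-- A prime dividing `(m + k).choose k` divides `m + j` for some `1 ≤ j ≤ k`. -/
theorem Nat.Prime.exists_dvd_add_of_dvd_choose {p : ℕ} (hp : p.Prime) {m k : ℕ}
    (h : p ∣ (m + k).choose k) : ∃ j, 1 ≤ j ∧ j ≤ k ∧ p ∣ m + j := by
  have hprod := h.mul_left k.factorial
  rw [← Nat.ascFactorial_eq_factorial_mul_choose, Nat.ascFactorial_eq_prod_range,
    hp.prime.dvd_finsetProd_iff] at hprod
  obtain ⟨i, hi, hdvd⟩ := hprod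
  refine ⟨i + 1, by omega, Finset.mem_range.mp hi, ?_⟩
  rwa [add_assoc, add_comm 1 i] at hdvd

theorem exists_cong_of_dvd_choose (n r : ℕ) (hn : 1 ≤ n) (p : ℕ) (hp : p.Prime)
    (hpn : p ∣ n) (hpc : p ∣ (n + r).choose r) (hr : r < p ^ 2) :
    1 ≤ r / p ∧ ∃ j : ℕ, 1 ≤ j ∧ j ≤ r / p ∧ ((n / p : ℕ) : ℤ) ≡ -(j : ℤ) [ZMOD (p : ℤ)] := by
  obtain ⟨j, hj, hjr, hdvd⟩ := hp.exists_dvd_add_of_dvd_choose (hp.dvd_choose_div hpn hpc)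
  refine ⟨hj.trans hjr, j, hj, hjr, Int.ModEq.symm (Int.modEq_iff_dvd.mpr ?_)⟩
  rw [sub_neg_eq_add]
  exact_mod_cast hdvd
end

section
/- Let r ≥ 0 and n ≥ 1 be integers and p a prime with p | n, p | C(n+r, r) and r < p². Then there exists an integer d with 1 ≤ d < p, d ≡ n/p (mod p), and d + ⌊r/p⌋ ≥ p. -/
theorem Nat.Prime.dvd_choose_iff_mod_div {p : ℕ} (hp : p.Prime) (n k : ℕ) :
    p ∣ n.choose k ↔ n % p < k % p ∨ p ∣ (n / p).choose (k / p) := by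
  have : Fact p.Prime := ⟨hp⟩
  rw [(Choose.choose_modEq_choose_mod_mul_choose_div_nat (n := n) (k := k)).dvd_iff dvd_rfl,
    hp.dvd_mul]
  refine or_congr_left ⟨fun h => ?_, fun h => by simp [Nat.choose_eq_zero_of_lt h]⟩
  by_contra! hle
  exact absurd ((hp.dvd_factorial).1 (h.trans ⟨(k % p).factorial * (n % p - k % p).factorial,
    by rw [← mul_assoc, Nat.choose_mul_factorial_mul_factorial hle]⟩))
    (Nat.mod_lt _ hp.pos).not_ge

theorem exists_rep_of_dvd_choose (n r : ℕ) (hn : 1 ≤ n) (p : ℕ) (hp : p.Prime)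
    (hpn : p ∣ n) (hpc : p ∣ (n + r).choose r) (hr : r < p ^ 2) :
    ∃ d : ℕ, 1 ≤ d ∧ d < p ∧ d ≡ n / p [MOD p] ∧ p ≤ d + r / p := by
  obtain ⟨m, rfl⟩ := hpn
  have hq : r / p < p := Nat.div_lt_of_lt_mul (by rwa [← pow_two])
  have hd : m % p < p := Nat.mod_lt _ hp.pos
  rw [hp.dvd_choose_iff_mod_div, Nat.mul_add_mod, Nat.mul_add_div hp.pos,
    hp.dvd_choose_iff_mod_div, Nat.div_eq_of_lt hq, Nat.choose_zero_right,
    Nat.mod_eq_of_lt hq, Nat.add_mod, Nat.mod_eq_of_lt hq] at hpc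
  have key : p ≤ m % p + r / p := by
    by_contra! hlt
    rw [Nat.mod_eq_of_lt hlt] at hpc
    have := hp.not_dvd_one
    grind
  rw [Nat.mul_div_cancel_left m hp.pos]
  exact ⟨m % p, by omega, hd, Nat.mod_modEq m p, key⟩
end

section
/- Let r ≥ 0 and n ≥ 2 be integers, let p be the largest prime with p ≤ n, and set k = n − p. If r + k < p, then 𝓛_n^{⟨r⟩}(x) has no monic factor g ∈ ℚ[x] with k < deg g ≤ n/2. -/
open Polynomial

/-- The monic integer polynomial `𝓛_n^{⟨r⟩}(x) = ∑_{j=0}^{n} C(n,j)·(r+1)⋯(r+n−j)·x^j`,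
viewed as a polynomial over `ℚ`. -/
noncomputable def laguerreL (n r : ℕ) : Polynomial ℚ :=
  ∑ j ∈ Finset.range (n + 1),
    Polynomial.C ((n.choose j : ℚ) * ∏ t ∈ Finset.Icc 1 (n - j), ((r : ℚ) + (t : ℚ))) *
      Polynomial.X ^ j

/-- The polynomial `laguerreL n r` with its coefficients taken in `ℤ`. -/
noncomputable def laguerreInt (n r : ℕ) : ℤ[X] :=
  ∑ j ∈ Finset.range (n + 1),
    C ((n.choose j * ∏ t ∈ Finset.Icc 1 (n - j), (r + t) : ℕ) : ℤ) * X ^ j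

theorem map_laguerreInt (n r : ℕ) :
    (laguerreInt n r).map (algebraMap ℤ ℚ) = laguerreL n r := by
  simp only [laguerreInt, laguerreL, Polynomial.map_sum, Polynomial.map_mul, Polynomial.map_pow,
    map_C, map_X]
  simp

theorem coeff_laguerreInt (n r j : ℕ) :
    (laguerreInt n r).coeff j =
      ((n.choose j * ∏ t ∈ Finset.Icc 1 (n - j), (r + t) : ℕ) : ℤ) := by
  simp only [laguerreInt, finsetSum_coeff, coeff_C_mul_X_pow]
  rw [Finset.sum_ite_eq]
  split_ifs with h
  · rfl
  · rw [Nat.choose_eq_zero_of_lt (by simpa using h)]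
    simp

theorem natDegree_laguerreInt (n r : ℕ) : (laguerreInt n r).natDegree = n := by
  refine natDegree_eq_of_le_of_coeff_ne_zero ?_ ?_
  · rw [natDegree_le_iff_coeff_eq_zero]
    intro j hj
    rw [coeff_laguerreInt, Nat.choose_eq_zero_of_lt hj]
    simp
  · simp [coeff_laguerreInt]

theorem monic_laguerreInt (n r : ℕ) : (laguerreInt n r).Monic := by
  rw [Monic, leadingCoeff, natDegree_laguerreInt, coeff_laguerreInt]
  simp

theorem Nat.Prime.lt_two_mul_of_forall_le {n p : ℕ} (hp : p.Prime)
    (hmax : ∀ q : ℕ, q.Prime → q ≤ n → q ≤ p) : n < 2 * p := by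
  by_contra! hn
  obtain ⟨q, hq, hpq, hqp⟩ := Nat.exists_prime_lt_and_le_two_mul p hp.ne_zero
  exact hpq.not_ge (hmax q hq (hqp.trans hn))

theorem Nat.Prime.not_sq_dvd_factorial {p m : ℕ} (hp : p.Prime) (hm : m < 2 * p) :
    ¬ p ^ 2 ∣ m.factorial := by
  have hlog : Nat.log p m < 2 :=
    Nat.log_lt_of_lt_pow' two_ne_zero (by nlinarith [hp.two_le])
  rw [hp.pow_dvd_factorial_iff hlog]
  have : m / p < 2 := Nat.div_lt_of_lt_mul (by linarith)
  simpa using this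

theorem factorial_mul_prod_add (r m : ℕ) :
    r.factorial * ∏ t ∈ Finset.Icc 1 m, (r + t) = (r + m).factorial := by
  induction m with
  | zero => simp
  | succ m ih =>
    rw [Finset.prod_Icc_succ_top (by omega), ← mul_assoc, ih, ← add_assoc, Nat.factorial_succ,
      mul_comm]

theorem prime_dvd_coeff_laguerreInt {n r p j : ℕ} (hp : p.Prime) (hpn : p ≤ n)
    (h : r + (n - p) < p) (hj : j < p) : (p : ℤ) ∣ (laguerreInt n r).coeff j := by
  rw [coeff_laguerreInt, Int.natCast_dvd_natCast]
  by_cases hjr : p ≤ r + (n - j)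
  · refine Dvd.dvd.mul_left ?_ _
    have hmem : p - r ∈ Finset.Icc 1 (n - j) := by
      rw [Finset.mem_Icc]
      omega
    have hdvd := Finset.dvd_prod_of_mem (fun t => r + t) hmem
    rwa [Nat.add_sub_cancel' (by omega)] at hdvd
  · refine Dvd.dvd.mul_right ?_ _
    exact hp.dvd_choose hj (by omega) hpn

theorem not_sq_dvd_coeff_zero_laguerreInt {n r p : ℕ} (hp : p.Prime) (hpn : p ≤ n)
    (h : r + (n - p) < p) : ¬ (p : ℤ) ^ 2 ∣ (laguerreInt n r).coeff 0 := by
  rw [coeff_laguerreInt, ← Nat.cast_pow, Int.natCast_dvd_natCast]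
  intro hdvd
  refine hp.not_sq_dvd_factorial (m := r + n) (by omega) ?_
  rw [← factorial_mul_prod_add]
  exact Dvd.dvd.mul_left (by simpa using hdvd) _

/-- If `p` divides the coefficients of `g * h` below degree `m` but not the constant coefficient
of the monic polynomial `g`, then `m ≤ h.natDegree`. -/
theorem le_natDegree_of_prime_dvd_coeff_mul {g h : ℤ[X]} {p m : ℕ} (hp : p.Prime)
    (hh : h.Monic) (hgh : ∀ j < m, (p : ℤ) ∣ (g * h).coeff j) (hg : ¬ (p : ℤ) ∣ g.coeff 0) :
    m ≤ h.natDegree := by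
  have : Fact p.Prime := ⟨hp⟩
  let φ := Int.castRingHom (ZMod p)
  have hdvd : (X : (ZMod p)[X]) ^ m ∣ g.map φ * h.map φ := by
    rw [← Polynomial.map_mul, X_pow_dvd_iff]
    intro j hj
    rw [coeff_map]
    exact (ZMod.intCast_zmod_eq_zero_iff_dvd _ p).2 (hgh j hj)
  have hX : ¬ (X : (ZMod p)[X]) ∣ g.map φ := by
    rw [X_dvd_iff, coeff_map]
    exact fun h0 => hg ((ZMod.intCast_zmod_eq_zero_iff_dvd _ p).1 h0)
  have hle := natDegree_le_of_dvd (prime_X.pow_dvd_of_dvd_mul_left _ hX hdvd) (hh.map φ).ne_zero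
  rwa [natDegree_X_pow, hh.natDegree_map] at hle

theorem laguerre_no_large_factor (n r : ℕ) (hn : 2 ≤ n) (p : ℕ) (hp : p.Prime) (hpn : p ≤ n)
    (hmax : ∀ q : ℕ, q.Prime → q ≤ n → q ≤ p) (h : r + (n - p) < p) :
    ¬ ∃ g : Polynomial ℚ, g.Monic ∧ g ∣ laguerreL n r ∧
        n - p < g.natDegree ∧ 2 * g.natDegree ≤ n := by
  rintro ⟨g, hg, hdvd, hlt, hle⟩
  rw [← map_laguerreInt] at hdvd
  have hn2p := hp.lt_two_mul_of_forall_le hmax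
  have hinj : Function.Injective (algebraMap ℤ ℚ) := (algebraMap ℤ ℚ).injective_int
  obtain ⟨g, rfl⟩ : ∃ g' : ℤ[X], g'.map (algebraMap ℤ ℚ) = g := by
    simpa [hg.leadingCoeff] using
      IsIntegrallyClosed.eq_map_mul_C_of_dvd ℚ (monic_laguerreInt n r) hdvd
  replace hg : g.Monic := monic_of_injective hinj hg
  obtain ⟨f, hf⟩ := (map_dvd_map _ hinj hg).1 hdvd
  rw [hg.natDegree_map] at hlt hle
  have hfm : f.Monic := hg.of_mul_monic_left (hf ▸ monic_laguerreInt n r)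
  have hdeg : g.natDegree + f.natDegree = n := by
    rw [← hg.natDegree_mul hfm, ← hf, natDegree_laguerreInt]
  have hcoeff : ∀ j < p, (p : ℤ) ∣ (g * f).coeff j := fun j hj =>
    hf ▸ prime_dvd_coeff_laguerreInt hp hpn h hj
  by_cases hg0 : (p : ℤ) ∣ g.coeff 0
  · by_cases hf0 : (p : ℤ) ∣ f.coeff 0
    · refine not_sq_dvd_coeff_zero_laguerreInt hp hpn h ?_
      rw [hf, mul_coeff_zero, sq]
      exact mul_dvd_mul hg0 hf0
    · rw [mul_comm] at hcoeff
      have := le_natDegree_of_prime_dvd_coeff_mul hp hg hcoeff hf0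
      omega
  · have := le_natDegree_of_prime_dvd_coeff_mul hp hfm hcoeff hg0
    omega
end

section
/- Let r ≥ 0 and n ≥ 2 be integers, let P be the largest prime with P ≤ n, and set k = n − P. Let l be an integer with 1 ≤ l ≤ k such that there exists a prime p with p | (n − l), p > k, and p ∤ C(n+r, r). Then 𝓛_n^{⟨r⟩}(x) has no monic factor g ∈ ℚ[x] with l < deg g ≤ k and deg g ≤ n/2. -/
open Polynomial

theorem padicValNat_factorial_eq_div_add (p : ℕ) [hp : Fact p.Prime] (t : ℕ) :
    padicValNat p t.factorial = padicValNat p (t / p).factorial + t / p := by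
  rw [← padicValNat_mul_div_factorial t, padicValNat_factorial_mul]

theorem padicValNat_factorial_pow_succ (p : ℕ) [hp : Fact p.Prime] (i : ℕ) :
    padicValNat p (p ^ (i + 1)).factorial = padicValNat p (p ^ i).factorial + p ^ i := by
  rw [pow_succ', padicValNat_factorial_mul]

theorem padicValNat_factorial_pow_succ_modEq_one (p : ℕ) [hp : Fact p.Prime] (i : ℕ) :
    padicValNat p (p ^ (i + 1)).factorial ≡ 1 [MOD p] := by
  induction i with
  | zero => rw [padicValNat_factorial_pow_succ]; simp [Nat.ModEq]
  | succ i ih =>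
    rw [padicValNat_factorial_pow_succ]
    exact ih.add_right_cancel' 0 |>.add (Nat.modEq_zero_iff_dvd.mpr (dvd_pow_self p i.succ_ne_zero))

theorem padicValNat_factorial_mul_pow_le (p : ℕ) [hp : Fact p.Prime] (m t : ℕ)
    (ht : t < p ^ (m + 1)) :
    padicValNat p t.factorial * p ^ m ≤ t * padicValNat p (p ^ m).factorial := by
  induction m generalizing t with
  | zero =>
    have : padicValNat p t.factorial = 0 := by
      rw [padicValNat_factorial_eq_div_add, Nat.div_eq_of_lt (by simpa using ht)]; simp
    simp [this]
  | succ m ih =>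
    have h := ih (t / p) (Nat.div_lt_of_lt_mul (by rwa [← pow_succ']))
    rw [padicValNat_factorial_eq_div_add, padicValNat_factorial_pow_succ]
    calc _ = p * (padicValNat p (t / p).factorial * p ^ m) + p * (t / p) * p ^ m := by ring
      _ ≤ p * (t / p * padicValNat p (p ^ m).factorial) + p * (t / p) * p ^ m := by gcongr
      _ = p * (t / p) * (padicValNat p (p ^ m).factorial + p ^ m) := by ring
      _ ≤ _ := by gcongr; exact Nat.mul_div_le t p

theorem padicValNat_factorial_mul_pow_add (p : ℕ) [hp : Fact p.Prime] (q i t : ℕ)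
    (ht : t < p ^ i) :
    padicValNat p (q * p ^ i + t).factorial =
      padicValNat p (q * p ^ i).factorial + padicValNat p t.factorial := by
  induction i generalizing t with
  | zero => simp [show t = 0 by simpa using ht]
  | succ i ih =>
    have hp0 := hp.out.pos
    have h1 : (q * p ^ (i + 1) + t) / p = q * p ^ i + t / p := by
      rw [pow_succ, ← mul_assoc, mul_comm _ p, Nat.mul_add_div hp0]
    have h2 : q * p ^ (i + 1) = p * (q * p ^ i) := by ring
    rw [padicValNat_factorial_eq_div_add, h1,
      ih (t / p) (Nat.div_lt_of_lt_mul (by rwa [← pow_succ'])), h2, padicValNat_factorial_mul,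
      padicValNat_factorial_eq_div_add p t]
    ring

theorem padicValNat_factorial_add_le (p : ℕ) [hp : Fact p.Prime] (a b : ℕ) :
    padicValNat p a.factorial + padicValNat p b.factorial ≤ padicValNat p (a + b).factorial := by
  rw [← padicValNat.mul a.factorial_ne_zero b.factorial_ne_zero]
  exact (padicValNat_dvd_iff_le (a + b).factorial_ne_zero).mp
    (pow_padicValNat_dvd.trans (Nat.factorial_mul_factorial_dvd_factorial_add a b))

theorem padicValNat_factorial_add_mul_le (p : ℕ) [hp : Fact p.Prime] (a b s : ℕ) :
    padicValNat p a.factorial + s * padicValNat p b.factorial ≤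
      padicValNat p (a + s * b).factorial := by
  induction s with
  | zero => simp
  | succ s ih =>
    have := padicValNat_factorial_add_le p (a + s * b) b
    rw [show a + (s + 1) * b = a + s * b + b by ring]
    linarith

/-- The function `j ↦ u j - e v_p(j!)` on `[0, n]` has a unique minimum, at a number obtained from
`n` by clearing low base-`p` digits, provided that `0 < u` and `0 < e < p`. -/
theorem exists_unique_min_sub_padicValNat_factorial (p : ℕ) [hp : Fact p.Prime] (u e n : ℕ)
    (hu : 0 < u) (he : 0 < e) (hep : e < p) :
    ∃ i, ∀ j ≤ n, j ≠ n / p ^ i * p ^ i →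
      e * padicValNat p j.factorial + u * (n / p ^ i * p ^ i) <
        e * padicValNat p (n / p ^ i * p ^ i).factorial + u * j := by
  have hp1 := hp.out.one_lt
  have hne (m : ℕ) : u * p ^ m ≠ e * padicValNat p (p ^ m).factorial := by
    cases m with
    | zero => simp [hu.ne']
    | succ m =>
      intro h
      have hd : p ∣ e * padicValNat p (p ^ (m + 1)).factorial :=
        h ▸ (dvd_pow_self p m.succ_ne_zero).mul_left u
      rcases hp.out.dvd_mul.mp hd with hd | hd
      · exact absurd (Nat.le_of_dvd he hd) (by omega)
      · rw [(padicValNat_factorial_pow_succ_modEq_one p m).dvd_iff dvd_rfl] at hd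
        exact hp.out.one_lt.ne' (Nat.dvd_one.mp hd)
  have hex : ∃ i, u * p ^ i < e * padicValNat p (p ^ i).factorial ∨ n < p ^ i :=
    ⟨n, Or.inr (Nat.lt_pow_self hp1)⟩
  have hi := Nat.find_spec hex
  have hmin m (hm : m < Nat.find hex) := Nat.find_min hex hm
  set i := Nat.find hex
  refine ⟨i, fun j hj hjne => ?_⟩
  have hpos : 0 < p ^ i := by positivity
  have hsmall (t : ℕ) (ht0 : 0 < t) (ht : t < p ^ i) : e * padicValNat p t.factorial < u * t := by
    have hlog : Nat.log p t < i := Nat.log_lt_of_lt_pow ht0.ne' ht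
    have hm := hmin _ hlog
    push Not at hm
    have h1 := lt_of_le_of_ne hm.1 (hne _).symm
    have h2 := padicValNat_factorial_mul_pow_le p (Nat.log p t) t (Nat.lt_pow_succ_log_self hp1 t)
    refine lt_of_mul_lt_mul_right (a := p ^ Nat.log p t) ?_ (Nat.zero_le _)
    calc _ = e * (padicValNat p t.factorial * p ^ Nat.log p t) := by ring
      _ ≤ e * (t * padicValNat p (p ^ Nat.log p t).factorial) := by gcongr
      _ = t * (e * padicValNat p (p ^ Nat.log p t).factorial) := by ring
      _ < t * (u * p ^ Nat.log p t) := by gcongr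
      _ = _ := by ring
  have hlow : e * padicValNat p j.factorial + u * (j / p ^ i * p ^ i) ≤
        e * padicValNat p (j / p ^ i * p ^ i).factorial + u * j ∧
      (e * padicValNat p j.factorial + u * (j / p ^ i * p ^ i) =
        e * padicValNat p (j / p ^ i * p ^ i).factorial + u * j → j = j / p ^ i * p ^ i) := by
    have h := padicValNat_factorial_mul_pow_add p (j / p ^ i) i (j % p ^ i) (Nat.mod_lt _ hpos)
    have hdm := Nat.div_add_mod' j (p ^ i)
    rw [hdm] at h
    have huj : u * j = u * (j / p ^ i * p ^ i) + u * (j % p ^ i) := by rw [← mul_add, hdm]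
    rw [h, huj, mul_add]
    rcases Nat.eq_zero_or_pos (j % p ^ i) with h0 | h0
    · rw [h0] at hdm ⊢
      simp only [Nat.factorial_zero, padicValNat_one_right, mul_zero, add_zero, le_refl, true_and]
      intro; omega
    · have := hsmall _ h0 (Nat.mod_lt _ hpos)
      constructor <;> omega
  obtain ⟨s, hs⟩ := Nat.exists_eq_add_of_le (Nat.div_le_div_right (c := p ^ i) hj)
  rcases Nat.eq_zero_or_pos s with rfl | hs0
  · rw [add_zero] at hs
    rw [hs] at hjne ⊢
    exact lt_of_le_of_ne hlow.1 fun h => hjne (hlow.2 h)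
  · have hw : u * p ^ i < e * padicValNat p (p ^ i).factorial := by
      refine hi.resolve_right fun h => ?_
      rw [Nat.div_eq_of_lt h] at hs
      exact hs0.ne' (Nat.eq_zero_of_add_eq_zero_left hs.symm)
    have h1 := padicValNat_factorial_add_mul_le p (j / p ^ i * p ^ i) (p ^ i) s
    have h2 : u * p ^ i * s < e * padicValNat p (p ^ i).factorial * s := by gcongr
    rw [hs, add_mul]
    nlinarith [hlow.1]

theorem not_dvd_choose_mod_pow_add (p : ℕ) [hp : Fact p.Prime] (n r i : ℕ)
    (h : ¬ p ∣ (n + r).choose r) : ¬ p ∣ (n % p ^ i + r).choose r := by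
  set b := Nat.log p (n + r) + 1
  have hlog : Nat.log p (n % p ^ i + r) < b :=
    Nat.lt_succ_of_le (Nat.log_mono_right (Nat.add_le_add_right (Nat.mod_le _ _) r))
  have h1 := padicValNat.eq_zero_of_not_dvd h
  rw [padicValNat_choose' (Nat.lt_succ_self _), Finset.card_eq_zero,
    Finset.filter_eq_empty_iff] at h1
  have h2 : padicValNat p ((n % p ^ i + r).choose r) = 0 := by
    rw [padicValNat_choose' hlog, Finset.card_eq_zero, Finset.filter_eq_empty_iff]
    intro s hs hle
    refine h1 hs (hle.trans (Nat.add_le_add_left ?_ _))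
    rcases le_total s i with hsi | hsi
    · exact (Nat.mod_mod_of_dvd n (pow_dvd_pow p hsi)).le
    · rw [← Nat.mod_mod_of_dvd n (pow_dvd_pow p hsi)]
      exact (Nat.mod_le _ _).trans (Nat.mod_le _ _)
  intro hd
  have := one_le_padicValNat_of_dvd (Nat.choose_pos (Nat.le_add_left _ _)).ne' hd
  omega

/-- The terms of `f` of maximal Gauss size `‖f.coeff i‖ * c ^ i` have indices between `a` and `b`,
and the terms at `a` and `b` are of maximal size. -/
def GaussMaximal {K : Type*} [NormedField K] (f : K[X]) (c : ℝ) (a b : ℕ) : Prop :=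
  0 < ‖f.coeff a‖ * c ^ a ∧ (∀ i, ‖f.coeff i‖ * c ^ i ≤ ‖f.coeff a‖ * c ^ a) ∧
    ‖f.coeff b‖ * c ^ b = ‖f.coeff a‖ * c ^ a ∧
    ∀ i, ‖f.coeff i‖ * c ^ i = ‖f.coeff a‖ * c ^ a → a ≤ i ∧ i ≤ b

theorem exists_gaussMaximal {K : Type*} [NormedField K] {f : K[X]} (hf : f ≠ 0) {c : ℝ}
    (hc : 0 < c) : ∃ a b, GaussMaximal f c a b := by
  classical
  obtain ⟨m, hm, hmax⟩ := Finset.exists_max_image f.support (fun i => ‖f.coeff i‖ * c ^ i)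
    (support_nonempty.mpr hf)
  have hm0 : 0 < ‖f.coeff m‖ * c ^ m :=
    mul_pos (norm_pos_iff.mpr (mem_support_iff.mp hm)) (pow_pos hc m)
  have hle (i : ℕ) : ‖f.coeff i‖ * c ^ i ≤ ‖f.coeff m‖ * c ^ m := by
    by_cases hi : i ∈ f.support
    · exact hmax i hi
    · simpa [notMem_support_iff.mp hi] using hm0.le
  let S := f.support.filter fun i => ‖f.coeff i‖ * c ^ i = ‖f.coeff m‖ * c ^ m
  have hS : S.Nonempty := ⟨m, Finset.mem_filter.mpr ⟨hm, rfl⟩⟩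
  have hmin := (Finset.mem_filter.mp (S.min'_mem hS)).2
  have hmax := (Finset.mem_filter.mp (S.max'_mem hS)).2
  refine ⟨S.min' hS, S.max' hS, ?_, ?_, hmax.trans hmin.symm, fun i hi => ?_⟩
  · rwa [hmin]
  · rwa [hmin]
  · rw [hmin] at hi
    have hiS : i ∈ S := by
      refine Finset.mem_filter.mpr ⟨mem_support_iff.mpr fun h0 => ?_, hi⟩
      simp [← hi, h0] at hm0
    exact ⟨S.min'_le i hiS, S.le_max' i hiS⟩

section Ultrametric

variable {K : Type*} [NormedField K] [IsUltrametricDist K] {g h : K[X]} {c : ℝ}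

theorem norm_coeff_mul_mul_pow_le (hc : 0 ≤ c) {A B : ℝ} (hg : ∀ i, ‖g.coeff i‖ * c ^ i ≤ A)
    (hh : ∀ i, ‖h.coeff i‖ * c ^ i ≤ B) (j : ℕ) : ‖(g * h).coeff j‖ * c ^ j ≤ A * B := by
  rw [coeff_mul]
  obtain ⟨x, hx, hle⟩ := IsUltrametricDist.exists_norm_finsetSum_le_of_nonempty
    (t := Finset.HasAntidiagonal.antidiagonal j) ⟨(0, j), by simp⟩
    fun x => g.coeff x.1 * h.coeff x.2
  rw [← Finset.HasAntidiagonal.mem_antidiagonal.mp hx]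
  calc _ ≤ ‖g.coeff x.1 * h.coeff x.2‖ * c ^ (x.1 + x.2) := by
        rw [Finset.HasAntidiagonal.mem_antidiagonal.mp hx]; gcongr
    _ = (‖g.coeff x.1‖ * c ^ x.1) * (‖h.coeff x.2‖ * c ^ x.2) := by rw [norm_mul, pow_add]; ring
    _ ≤ A * B := mul_le_mul (hg _) (hh _) (by positivity) ((by positivity : (0:ℝ) ≤ _).trans (hg 0))

theorem norm_coeff_mul_add_of_forall_lt (hc : 0 < c) {a b : ℕ}
    (hpos : 0 < (‖g.coeff a‖ * c ^ a) * (‖h.coeff b‖ * c ^ b))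
    (hlt : ∀ i j, i + j = a + b → i ≠ a →
      (‖g.coeff i‖ * c ^ i) * (‖h.coeff j‖ * c ^ j) <
        (‖g.coeff a‖ * c ^ a) * (‖h.coeff b‖ * c ^ b)) :
    ‖(g * h).coeff (a + b)‖ * c ^ (a + b) = (‖g.coeff a‖ * c ^ a) * (‖h.coeff b‖ * c ^ b) := by
  have hterm (i j : ℕ) (hij : i + j = a + b) :
      (‖g.coeff i‖ * c ^ i) * (‖h.coeff j‖ * c ^ j) =
        ‖g.coeff i * h.coeff j‖ * c ^ (a + b) := by
    rw [norm_mul, ← hij, pow_add]; ring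
  rw [hterm a b rfl] at hpos ⊢
  have hab : 0 < ‖g.coeff a * h.coeff b‖ := pos_of_mul_pos_left hpos (by positivity)
  congr 1
  have hmem : (a, b) ∈ Finset.HasAntidiagonal.antidiagonal (a + b) := by simp
  rw [coeff_mul, ← Finset.add_sum_erase _ _ hmem]
  have hrest : ‖∑ x ∈ (Finset.HasAntidiagonal.antidiagonal (a + b)).erase (a, b),
      g.coeff x.1 * h.coeff x.2‖ < ‖g.coeff a * h.coeff b‖ := by
    rcases ((Finset.HasAntidiagonal.antidiagonal (a + b)).erase (a, b)).eq_empty_or_nonempty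
      with h0 | h0
    · rwa [h0, Finset.sum_empty, norm_zero]
    · obtain ⟨x, hx, hle⟩ := IsUltrametricDist.exists_norm_finsetSum_le_of_nonempty h0
        fun x => g.coeff x.1 * h.coeff x.2
      refine hle.trans_lt ?_
      obtain ⟨hne, hx⟩ := Finset.mem_erase.mp hx
      have hsum := Finset.HasAntidiagonal.mem_antidiagonal.mp hx
      have := hlt x.1 x.2 hsum fun h1 => hne (Prod.ext h1 (by dsimp; omega))
      rw [hterm _ _ hsum, hterm a b rfl] at this
      exact lt_of_mul_lt_mul_right this (by positivity)
  rw [IsUltrametricDist.norm_add_eq_max_of_norm_ne_norm hrest.ne', max_eq_left hrest.le]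

theorem GaussMaximal.norm_coeff_mul {a b a' b' : ℕ} (hc : 0 < c) (hg : GaussMaximal g c a b)
    (hh : GaussMaximal h c a' b') :
    (∀ j, ‖(g * h).coeff j‖ * c ^ j ≤ (‖g.coeff a‖ * c ^ a) * (‖h.coeff a'‖ * c ^ a')) ∧
    ‖(g * h).coeff (a + a')‖ * c ^ (a + a') =
      (‖g.coeff a‖ * c ^ a) * (‖h.coeff a'‖ * c ^ a') ∧
    ‖(g * h).coeff (b + b')‖ * c ^ (b + b') =
      (‖g.coeff a‖ * c ^ a) * (‖h.coeff a'‖ * c ^ a') := by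
  obtain ⟨hg0, hgle, hgb, hgab⟩ := hg
  obtain ⟨hh0, hhle, hhb, hhab⟩ := hh
  have key (i j : ℕ) (hij : ‖g.coeff i‖ * c ^ i ≠ ‖g.coeff a‖ * c ^ a ∨
      ‖h.coeff j‖ * c ^ j ≠ ‖h.coeff a'‖ * c ^ a') :
      (‖g.coeff i‖ * c ^ i) * (‖h.coeff j‖ * c ^ j) <
        (‖g.coeff a‖ * c ^ a) * (‖h.coeff a'‖ * c ^ a') := by
    rcases hij with hi | hj
    · exact mul_lt_mul_of_lt_of_le_of_nonneg_of_pos ((hgle i).lt_of_ne hi) (hhle j)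
        (by positivity) hh0
    · exact mul_lt_mul' (hgle i) ((hhle j).lt_of_ne hj) (by positivity) hg0
  refine ⟨norm_coeff_mul_mul_pow_le hc.le hgle hhle, ?_, ?_⟩
  · refine norm_coeff_mul_add_of_forall_lt hc (mul_pos hg0 hh0) fun i j hij hia => key i j ?_
    by_contra! hcon
    have := hgab i hcon.1
    have := hhab j hcon.2
    omega
  · rw [← hgb, ← hhb]
    refine norm_coeff_mul_add_of_forall_lt hc (by rw [hgb, hhb]; exact mul_pos hg0 hh0)
      fun i j hij hia => ?_
    rw [hgb, hhb]
    refine key i j ?_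
    by_contra! hcon
    have := hgab i hcon.1
    have := hhab j hcon.2
    omega

/-- If the residual polynomial of a monic integral `g * h` is `X ^ (n - l)` times a polynomial
and `g` has degree more than `l`, then the residual polynomial of `g` vanishes at `0`. -/
theorem norm_coeff_zero_lt_one_of_monic_mul (hg : g.Monic) (hh : h.Monic) {l : ℕ}
    (hle : ∀ j, ‖(g * h).coeff j‖ ≤ 1)
    (hlt : ∀ j, j + l < (g * h).natDegree → ‖(g * h).coeff j‖ < 1) (hl : l < g.natDegree) :
    ‖g.coeff 0‖ < 1 := by
  obtain ⟨a, b, hgm⟩ := exists_gaussMaximal hg.ne_zero one_pos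
  obtain ⟨a', b', hhm⟩ := exists_gaussMaximal hh.ne_zero one_pos
  obtain ⟨-, hmul, -⟩ := hgm.norm_coeff_mul one_pos hhm
  obtain ⟨-, hgle, -, hgab⟩ := hgm
  obtain ⟨-, hhle, -, hhab⟩ := hhm
  simp only [one_pow, mul_one] at *
  have h1 := hgle g.natDegree
  have h2 := hhle h.natDegree
  rw [hg.coeff_natDegree, norm_one] at h1
  rw [hh.coeff_natDegree, norm_one] at h2
  have h3 := hle (a + a')
  have hga : ‖g.coeff a‖ = 1 := by nlinarith
  have hha : ‖h.coeff a'‖ = 1 := by nlinarith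
  have ha' : a' ≤ h.natDegree := (hhab h.natDegree (by rw [hh.coeff_natDegree, norm_one, hha])).1
  have hsum : (g * h).natDegree ≤ a + a' + l := by
    by_contra! hcon
    have := hlt _ hcon
    rw [hmul, hga, hha] at this
    norm_num at this
  rw [hg.natDegree_mul hh] at hsum
  refine hga ▸ (hgle 0).lt_of_ne fun h0 => ?_
  have := (hgab 0 h0).1
  omega

end Ultrametric

/-- The first segment of the Newton polygon of `g` has negative slope `log c`. -/
theorem exists_newton_slope {K : Type*} [NormedField K] {g : K[X]} (hg : g.Monic)
    (h0 : g.coeff 0 ≠ 0) (h1 : ‖g.coeff 0‖ < 1) :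
    ∃ (e : ℕ) (c : ℝ), 0 < e ∧ e ≤ g.natDegree ∧ 0 < c ∧ c < 1 ∧
      (∀ i, ‖g.coeff i‖ * c ^ i ≤ ‖g.coeff 0‖) ∧ ‖g.coeff e‖ * c ^ e = ‖g.coeff 0‖ := by
  classical
  have hpos : 0 < ‖g.coeff 0‖ := norm_pos_iff.mpr h0
  have hd : g.natDegree ≠ 0 := fun hd => by
    have := hg.coeff_natDegree
    rw [hd] at this
    rw [this, norm_one] at h1
    exact lt_irrefl _ h1
  let ρ : ℕ → ℝ := fun i => (‖g.coeff 0‖ / ‖g.coeff i‖) ^ (i : ℝ)⁻¹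
  obtain ⟨e, he, hmin⟩ := Finset.exists_min_image (g.support.erase 0) ρ
    ⟨g.natDegree, by simp [hd, hg.ne_zero]⟩
  obtain ⟨he0, hes⟩ := Finset.mem_erase.mp he
  have hρ (i : ℕ) (hi : i ∈ g.support.erase 0) : 0 < ρ i ∧ ‖g.coeff i‖ * ρ i ^ i = ‖g.coeff 0‖ := by
    obtain ⟨hi0, his⟩ := Finset.mem_erase.mp hi
    have : 0 < ‖g.coeff i‖ := norm_pos_iff.mpr (mem_support_iff.mp his)
    refine ⟨by positivity, ?_⟩
    rw [Real.rpow_inv_natCast_pow (by positivity) hi0]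
    field_simp
  refine ⟨e, ρ e, Nat.pos_of_ne_zero he0, le_natDegree_of_mem_supp e hes, (hρ e he).1, ?_,
    fun i => ?_, (hρ e he).2⟩
  · refine (hmin g.natDegree (by simp [hd, hg.ne_zero])).trans_lt ?_
    refine Real.rpow_lt_one (by positivity) ?_ (by positivity)
    simpa [hg.coeff_natDegree] using h1
  · by_cases hi0 : i = 0
    · simp [hi0]
    by_cases his : i ∈ g.support
    · have hi := Finset.mem_erase.mpr ⟨hi0, his⟩
      rw [← (hρ i hi).2]
      have := (hρ e he).1
      gcongr
      exact hmin i hi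
    · simp [notMem_support_iff.mp his]

/-- If for each positive slope `u / e` with `e < p` only one term of `g * h` has maximal Gauss size,
a monic factor `g` of degree less than `p` cannot have a constant coefficient of norm in `(0, 1)`. -/
theorem Padic.not_norm_coeff_zero_lt_one {p : ℕ} [hp : Fact p.Prime] {g h : ℚ_[p][X]}
    (hg : g.Monic) (hh : h ≠ 0) (hd : g.natDegree < p) (h0 : g.coeff 0 ≠ 0)
    (hvertex : ∀ u e : ℕ, 0 < u → 0 < e → e < p → ∃ j₀, ∀ j ≠ j₀,
      ‖(g * h).coeff j‖ ^ e * ((p : ℝ)⁻¹ ^ u) ^ j <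
        ‖(g * h).coeff j₀‖ ^ e * ((p : ℝ)⁻¹ ^ u) ^ j₀) :
    ¬ ‖g.coeff 0‖ < 1 := by
  intro h1
  obtain ⟨e, c, he0, hed, hc0, hc1, hle, heq⟩ := exists_newton_slope hg h0 h1
  have hp1 : (1 : ℝ) < p := mod_cast hp.out.one_lt
  have hge : g.coeff e ≠ 0 := fun h => h0 (by simpa [h] using heq.symm)
  have hce : c ^ e = ‖g.coeff 0 / g.coeff e‖ := by
    rw [norm_div, ← heq]
    have := norm_ne_zero_iff.mpr hge
    field_simp
  have hlt : c ^ e < 1 := pow_lt_one₀ hc0.le hc1 he0.ne'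
  rw [hce, Padic.norm_eq_zpow_neg_valuation (div_ne_zero h0 hge),
    zpow_lt_one_iff_right₀ hp1] at hlt
  obtain ⟨u, hu⟩ := Int.eq_ofNat_of_zero_le (show 0 ≤ (g.coeff 0 / g.coeff e).valuation by omega)
  have hcu : c ^ e = (p : ℝ)⁻¹ ^ u := by
    rw [hce, Padic.norm_eq_zpow_neg_valuation (div_ne_zero h0 hge), hu]
    simp
  obtain ⟨j₀, hj₀⟩ := hvertex u e (by omega) he0 (by omega)
  have hlt' (j : ℕ) (hj : j ≠ j₀) :
      ‖(g * h).coeff j‖ * c ^ j < ‖(g * h).coeff j₀‖ * c ^ j₀ := by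
    refine lt_of_pow_lt_pow_left₀ e (by positivity) ?_
    have := hj₀ j hj
    rw [← hcu] at this
    simpa only [mul_pow, ← pow_mul, mul_comm e] using this
  obtain ⟨a, b, hgm⟩ := exists_gaussMaximal hg.ne_zero hc0
  obtain ⟨a', b', hhm⟩ := exists_gaussMaximal hh hc0
  obtain ⟨hall, hfst, hlst⟩ := hgm.norm_coeff_mul hc0 hhm
  have hj (j : ℕ) (hj : ‖(g * h).coeff j‖ * c ^ j =
      (‖g.coeff a‖ * c ^ a) * (‖h.coeff a'‖ * c ^ a')) : j = j₀ := by
    by_contra hne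
    exact absurd (hall j₀) (not_le.mpr (hj ▸ hlt' j hne))
  have h1 := hj _ hfst
  have h2 := hj _ hlst
  have ha'b' := (hhm.2.2.2 a' rfl).2
  have ha0 : ‖g.coeff 0‖ = ‖g.coeff a‖ * c ^ a :=
    le_antisymm (by simpa using hgm.2.1 0) (hle a)
  have ha := (hgm.2.2.2 0 (by simpa using ha0)).1
  have hb := (hgm.2.2.2 e (heq.trans ha0)).2
  omega

theorem laguerreL_coeff_eq_natCast (n r j : ℕ) :
    (laguerreL n r).coeff j =
      ((if j ≤ n then n.choose j * (r + 1).ascFactorial (n - j) else 0 : ℕ) : ℚ) := by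
  have hprod (m : ℕ) : ∏ t ∈ Finset.Icc 1 m, ((r : ℚ) + (t : ℚ)) =
      ((r + 1).ascFactorial m : ℕ) := by
    induction m with
    | zero => simp
    | succ m ih =>
      rw [Finset.prod_Icc_succ_top (by omega), ih, Nat.ascFactorial_succ]
      push_cast
      ring
  simp only [laguerreL, finsetSum_coeff, coeff_C_mul_X_pow, hprod]
  rw [Finset.sum_ite_eq]
  simp only [Finset.mem_range, Nat.lt_succ_iff]
  split_ifs <;> simp

theorem laguerreL_monic_and_natDegree (n r : ℕ) :
    (laguerreL n r).Monic ∧ (laguerreL n r).natDegree = n := by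
  have hcoeff : (laguerreL n r).coeff n = 1 := by simp [laguerreL_coeff_eq_natCast]
  have hdeg : (laguerreL n r).natDegree ≤ n := by
    refine natDegree_le_iff_coeff_eq_zero.mpr fun j hj => ?_
    simp [laguerreL_coeff_eq_natCast, not_le.mpr hj]
  exact ⟨monic_of_natDegree_le_of_coeff_eq_one n hdeg hcoeff,
    natDegree_eq_of_le_of_coeff_ne_zero hdeg (by simp [hcoeff])⟩

theorem choose_mul_ascFactorial_eq_descFactorial_mul (n r j : ℕ) (hj : j ≤ n) :
    n.choose j * (r + 1).ascFactorial (n - j) =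
      n.descFactorial (n - j) * (n - j + r).choose r := by
  rw [Nat.ascFactorial_eq_factorial_mul_choose, Nat.descFactorial_eq_factorial_mul_choose,
    Nat.choose_symm hj, add_comm r, ← Nat.choose_symm_add]
  ring

/-- If `p ∤ C(n + r, r)`, then for each positive slope `u / e` with `e < p` the Laguerre polynomial
has a unique term of maximal Gauss size. -/
theorem exists_vertex_laguerreL (p : ℕ) [hp : Fact p.Prime] (n r : ℕ)
    (hpc : ¬ p ∣ (n + r).choose r) (u e : ℕ) (hu : 0 < u) (he : 0 < e) (hep : e < p) :
    ∃ j₀, ∀ j ≠ j₀,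
      ‖((laguerreL n r).coeff j : ℚ_[p])‖ ^ e * ((p : ℝ)⁻¹ ^ u) ^ j <
        ‖((laguerreL n r).coeff j₀ : ℚ_[p])‖ ^ e * ((p : ℝ)⁻¹ ^ u) ^ j₀ := by
  obtain ⟨i, hi⟩ := exists_unique_min_sub_padicValNat_factorial p u e n hu he hep
  set j₀ := n / p ^ i * p ^ i
  have hj₀ : j₀ ≤ n := Nat.div_mul_le_self _ _
  have hmod : n - j₀ = n % p ^ i := by
    have := Nat.div_add_mod' n (p ^ i)
    omega
  have hp0 : (0 : ℝ) < (p : ℝ)⁻¹ := inv_pos.mpr (mod_cast hp.out.pos)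
  have hp1 : (p : ℝ)⁻¹ < 1 := inv_lt_one_of_one_lt₀ (mod_cast hp.out.one_lt)
  have hval (j : ℕ) (hj : j ≤ n) :
      padicValNat p j.factorial + padicValNat p (n.choose j * (r + 1).ascFactorial (n - j)) =
        padicValNat p n.factorial + padicValNat p ((n - j + r).choose r) := by
    have hmul : j.factorial * (n.choose j * (r + 1).ascFactorial (n - j)) =
        n.factorial * (n - j + r).choose r := by
      rw [choose_mul_ascFactorial_eq_descFactorial_mul n r j hj, ← mul_assoc,
        ← Nat.factorial_mul_descFactorial (Nat.sub_le n j), Nat.sub_sub_self hj]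
    have hc : (n - j + r).choose r ≠ 0 := (Nat.choose_pos (Nat.le_add_left _ _)).ne'
    rw [← padicValNat.mul j.factorial_ne_zero, hmul, padicValNat.mul n.factorial_ne_zero hc]
    exact mul_ne_zero (Nat.choose_pos hj).ne' (Nat.ascFactorial_pos _ _).ne'
  have hnorm (j : ℕ) (hj : j ≤ n) : ‖((laguerreL n r).coeff j : ℚ_[p])‖ =
      (p : ℝ)⁻¹ ^ padicValNat p (n.choose j * (r + 1).ascFactorial (n - j)) := by
    rw [laguerreL_coeff_eq_natCast, if_pos hj, Rat.cast_natCast,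
      Padic.norm_eq_zpow_neg_valuation, Padic.valuation_natCast]
    · simp
    · exact_mod_cast mul_ne_zero (Nat.choose_pos hj).ne' (Nat.ascFactorial_pos _ _).ne'
  refine ⟨j₀, fun j hj => ?_⟩
  rcases le_or_gt j n with hjn | hjn
  · rw [hnorm j hjn, hnorm j₀ hj₀]
    simp only [← pow_mul, ← pow_add]
    refine pow_lt_pow_right_of_lt_one₀ hp0 hp1 ?_
    have h1 := hval j hjn
    have h2 := hval j₀ hj₀
    rw [hmod, padicValNat.eq_zero_of_not_dvd (not_dvd_choose_mod_pow_add p n r i hpc), ← hmod]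
      at h2
    have h3 := hi j hjn hj
    have h4 : e * (padicValNat p j₀.factorial +
          padicValNat p (n.choose j₀ * (r + 1).ascFactorial (n - j₀))) ≤
        e * (padicValNat p j.factorial +
          padicValNat p (n.choose j * (r + 1).ascFactorial (n - j))) := by
      gcongr e * ?_
      omega
    linarith
  · rw [hnorm j₀ hj₀, laguerreL_coeff_eq_natCast, if_neg (not_le.mpr hjn)]
    simp only [Nat.cast_zero, Rat.cast_zero, norm_zero, zero_pow he.ne', zero_mul]
    positivity

theorem laguerre_no_factor_between (n r : ℕ) (hn : 2 ≤ n) (P : ℕ) (hP : P.Prime) (hPn : P ≤ n)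
    (hmax : ∀ q : ℕ, q.Prime → q ≤ n → q ≤ P) (l : ℕ) (hl1 : 1 ≤ l) (hl2 : l ≤ n - P)
    (p : ℕ) (hp : p.Prime) (hpl : p ∣ (n - l)) (hpk : n - P < p)
    (hpc : ¬ p ∣ (n + r).choose r) :
    ¬ ∃ g : Polynomial ℚ, g.Monic ∧ g ∣ laguerreL n r ∧
        l < g.natDegree ∧ g.natDegree ≤ n - P ∧ 2 * g.natDegree ≤ n := by
  rintro ⟨g, hg, ⟨h, hgh⟩, hlg, hgk, -⟩
  have : Fact p.Prime := ⟨hp⟩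
  obtain ⟨hmonic, hdeg⟩ := laguerreL_monic_and_natDegree n r
  have hh : h.Monic := hg.of_mul_monic_left (hgh ▸ hmonic)
  let φ := algebraMap ℚ ℚ_[p]
  have hmul : g.map φ * h.map φ = (laguerreL n r).map φ := by rw [hgh, Polynomial.map_mul]
  have hcoeff (j : ℕ) : (g.map φ * h.map φ).coeff j = ((laguerreL n r).coeff j : ℚ_[p]) := by
    rw [hmul, coeff_map, eq_ratCast]
  refine Padic.not_norm_coeff_zero_lt_one (hg.map φ) (hh.map φ).ne_zero ?_ ?_ ?_
    (norm_coeff_zero_lt_one_of_monic_mul (l := l) (hg.map φ) (hh.map φ) ?_ ?_ ?_)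
  · rw [natDegree_map]
    omega
  · intro h0
    have h1 := laguerreL_coeff_eq_natCast n r 0
    rw [coeff_map, map_eq_zero] at h0
    rw [hgh, mul_coeff_zero, h0, zero_mul, if_pos (Nat.zero_le n), Nat.choose_zero_right,
      one_mul] at h1
    exact (Nat.ascFactorial_pos r (n - 0)).ne' (by exact_mod_cast h1.symm)
  · simpa only [hcoeff] using exists_vertex_laguerreL p n r hpc
  · intro j
    rw [hcoeff, laguerreL_coeff_eq_natCast, Rat.cast_natCast]
    exact_mod_cast Padic.norm_int_le_one (p := p) (Int.ofNat _)
  · intro j hj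
    rw [hmul, natDegree_map, hdeg] at hj
    rw [hcoeff, laguerreL_coeff_eq_natCast, Rat.cast_natCast, Padic.norm_natCast_lt_one_iff,
      if_pos (by omega), choose_mul_ascFactorial_eq_descFactorial_mul n r j (by omega),
      Nat.descFactorial_eq_prod_range]
    refine Dvd.dvd.mul_right (hpl.trans (Finset.dvd_prod_of_mem (fun i => n - i) ?_)) _
    rw [Finset.mem_range]
    omega
  · rwa [natDegree_map]
end

section
/- Let m ≥ 197 be an odd integer and let t be an even integer with 4 ≤ t ≤ 60. Then for all integers i, j with 1 ≤ i < j ≤ t/2, the product (m + 2i)(m + 2j) is not a perfect square. -/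
/-- If `a` and `d` are odd, then `a * (a + 2 * d)` is congruent to `3` modulo `4`,
hence not a square. -/
theorem not_isSquare_mul_add_two_mul_of_odd {a d : ℕ} (ha : Odd a) (hd : Odd d) :
    ¬ IsSquare (a * (a + 2 * d)) := by
  rintro ⟨c, hc⟩
  have hmod : a * (a + 2 * d) % 4 = 3 := by
    obtain ⟨k, rfl⟩ := hd
    have h : a % 4 = 1 ∨ a % 4 = 3 := by have := Nat.odd_iff.mp ha; omega
    have h' : (a + 2 * (2 * k + 1)) % 4 = (a % 4 + 2) % 4 := by omega
    rw [Nat.mul_mod, h']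
    rcases h with h | h <;> simp [h]
  rw [hc, Nat.mul_mod] at hmod
  have : c % 4 < 4 := Nat.mod_lt _ (by norm_num)
  interval_cases c % 4 <;> omega

/-- If `a` is odd, `d` is even and positive, and `a * (a + 2 * d) = (a + d) ^ 2 - d ^ 2` is a
square `c ^ 2`, then `c` has the parity of `a + d`, so `c ≤ a + d - 2`, which bounds `a`. -/
theorem four_mul_add_le_of_isSquare {a d : ℕ} (ha : Odd a) (hd : Even d) (hpos : 0 < d)
    (h : IsSquare (a * (a + 2 * d))) : 4 * (a + d) ≤ d ^ 2 + 4 := by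
  obtain ⟨c, hc⟩ := h
  have hodd : Odd c := by
    have : Odd (c * c) := hc ▸ ha.mul (ha.add_even (even_two_mul d))
    exact (Nat.odd_mul.mp this).1
  have hlt : c < a + d := by nlinarith
  have hle : c + 2 ≤ a + d := by
    have := Nat.odd_iff.mp hodd
    have := Nat.odd_iff.mp (ha.add_even hd)
    omega
  nlinarith

theorem product_not_square (m : ℕ) (hm : 197 ≤ m) (hmodd : Odd m)
    (t : ℕ) (hteven : Even t) (ht1 : 4 ≤ t) (ht2 : t ≤ 60) :
    ∀ i j : ℕ, 1 ≤ i → i < j → j ≤ t / 2 → ¬ IsSquare ((m + 2 * i) * (m + 2 * j)) := by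
  intro i j hi hij hj hsq
  obtain ⟨d, rfl⟩ := Nat.exists_eq_add_of_lt hij
  have ha : Odd (m + 2 * i) := hmodd.add_even (even_two_mul i)
  rw [show m + 2 * (i + d + 1) = m + 2 * i + 2 * (d + 1) by ring] at hsq
  rcases Nat.even_or_odd (d + 1) with hd | hd
  · have hbound := four_mul_add_le_of_isSquare ha hd d.succ_pos hsq
    have hd28 : d + 1 ≤ 28 := by
      have := Nat.even_iff.mp hd
      omega
    nlinarith
  · exact not_isSquare_mul_add_two_mul_of_odd ha hd hsq
end

section
/- Let r ≥ 0 and n ≥ 1 be integers, p a prime, and for 0 ≤ m ≤ n set b_m = C(n,m)·∏_{t=1}^{m}(r+t). Then for every j with 1 ≤ j ≤ n: (p−1)·(ν_p(b_n) − ν_p(b_{n−j})) = j − σ_p(j) + (p−1)·ν_p(C(n+r, r)) − (p−1)·ν_p(C(n+r−j, r)). -/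
open Nat in
theorem prod_Icc_one_add_eq_factorial_mul_choose (r m : ℕ) :
    ∏ t ∈ Finset.Icc 1 m, (r + t) = m ! * (m + r).choose r := by
  induction m with
  | zero => simp
  | succ k ih =>
    rw [Finset.prod_Icc_succ_top (by omega), ih, Nat.factorial_succ]
    have h := Nat.add_one_mul_choose_eq (k + r) k
    rw [← Nat.choose_symm_add, ← Nat.choose_symm_add]
    rw [show k + 1 + r = k + r + 1 by ring]
    linear_combination k ! * h

open Nat in
theorem choose_mul_prod_Icc_mul_factorial (r : ℕ) {n m : ℕ} (hm : m ≤ n) :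
    n.choose m * (∏ t ∈ Finset.Icc 1 m, (r + t)) * (n - m)! = n ! * (m + r).choose r := by
  rw [prod_Icc_one_add_eq_factorial_mul_choose, ← Nat.choose_mul_factorial_mul_factorial hm]
  ring

open Nat in
theorem padicValNat_choose_mul_prod_Icc_add (p : ℕ) [Fact p.Prime] (r : ℕ) {n m : ℕ}
    (hm : m ≤ n) :
    padicValNat p (n.choose m * ∏ t ∈ Finset.Icc 1 m, (r + t)) + padicValNat p (n - m)! =
      padicValNat p n ! + padicValNat p ((m + r).choose r) := by
  have hb : n.choose m * ∏ t ∈ Finset.Icc 1 m, (r + t) ≠ 0 := by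
    refine mul_ne_zero (Nat.choose_pos hm).ne' (Finset.prod_ne_zero_iff.mpr fun t ht => ?_)
    have := (Finset.mem_Icc.mp ht).1
    omega
  rw [← padicValNat.mul hb (Nat.factorial_ne_zero _),
    ← padicValNat.mul (Nat.factorial_ne_zero _) (Nat.choose_pos (Nat.le_add_left r m)).ne',
    choose_mul_prod_Icc_mul_factorial r hm]

theorem slope_valuation_identity (n r : ℕ) (hn : 1 ≤ n) (p : ℕ) (hp : p.Prime)
    (b : ℕ → ℕ) (hb : ∀ m, m ≤ n → b m = n.choose m * ∏ t ∈ Finset.Icc 1 m, (r + t)) :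
    ∀ j, 1 ≤ j → j ≤ n →
      ((p : ℤ) - 1) * ((padicValNat p (b n) : ℤ) - (padicValNat p (b (n - j)) : ℤ)) =
        (j : ℤ) - ((Nat.digits p j).sum : ℤ)
          + ((p : ℤ) - 1) * (padicValNat p ((n + r).choose r) : ℤ)
          - ((p : ℤ) - 1) * (padicValNat p ((n + r - j).choose r) : ℤ) := by
  intro j _ hj
  have : Fact p.Prime := ⟨hp⟩
  have htop := padicValNat_choose_mul_prod_Icc_add p r (le_refl n)
  have hsub := padicValNat_choose_mul_prod_Icc_add p r (Nat.sub_le n j)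
  rw [← hb n le_rfl, Nat.sub_self, Nat.factorial_zero, padicValNat_one_right, add_zero] at htop
  rw [← hb _ (Nat.sub_le n j), Nat.sub_sub_self hj, ← Nat.sub_add_comm hj] at hsub
  have hleg := sub_one_mul_padicValNat_factorial (p := p) j
  have hdig := Nat.digit_sum_le p j
  have hone := hp.one_le
  generalize (Nat.digits p j).sum = s at *
  generalize padicValNat p (b n) = vtop at *
  generalize padicValNat p (b (n - j)) = vsub at *
  generalize padicValNat p ((n + r).choose r) = ctop at *
  generalize padicValNat p ((n + r - j).choose r) = csub at *
  generalize padicValNat p n.factorial = nfac at *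
  generalize padicValNat p j.factorial = vfac at *
  zify [hone, hdig] at htop hsub hleg
  linear_combination ((p : ℤ) - 1) * (htop - hsub) + hleg
end

section
/- Let r ≥ 0 and n ≥ 1 be integers and p a prime such that p | n or p | (r+1). Then p divides b_j = C(n,j)·(r+1)(r+2)⋯(r+j) for every j with 1 ≤ j ≤ n. -/
/-- A product of at least `p > 0` consecutive natural numbers is divisible by `p`. -/
theorem dvd_prod_Icc_add_of_le {p j : ℕ} (hp : 0 < p) (hpj : p ≤ j) (r : ℕ) :
    p ∣ ∏ t ∈ Finset.Icc 1 j, (r + t) := by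
  have hlt := Nat.mod_lt r hp
  have hmem : p - r % p ∈ Finset.Icc 1 j := Finset.mem_Icc.mpr ⟨by omega, by omega⟩
  refine dvd_trans ⟨r / p + 1, ?_⟩ (Finset.dvd_prod_of_mem (fun t => r + t) hmem)
  have hdiv := Nat.div_add_mod r p
  rw [mul_add, mul_one]
  omega

/-- If a prime `p` divides `n`, then it divides `n.choose j` for `0 < j < p`. -/
theorem Nat.Prime.dvd_choose_of_dvd_of_lt {p n j : ℕ} (hp : p.Prime) (hn : p ∣ n)
    (hj : 0 < j) (hjp : j < p) : p ∣ n.choose j := by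
  cases n with
  | zero => simp [Nat.choose_eq_zero_of_lt hj]
  | succ n =>
    obtain ⟨k, rfl⟩ := Nat.exists_eq_add_of_lt hj
    rw [zero_add] at hjp ⊢
    have hdvd : p ∣ (n + 1).choose (k + 1) * (k + 1) :=
      Nat.add_one_mul_choose_eq n k ▸ hn.mul_right _
    exact (hp.dvd_mul.mp hdvd).resolve_right (Nat.not_dvd_of_pos_of_lt k.succ_pos hjp)

theorem prime_dvd_coeffs (n r : ℕ) (hn : 1 ≤ n) (p : ℕ) (hp : p.Prime)
    (h : p ∣ n ∨ p ∣ (r + 1)) :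
    ∀ j, 1 ≤ j → j ≤ n → p ∣ n.choose j * ∏ t ∈ Finset.Icc 1 j, (r + t) := by
  intro j hj _
  rcases h with h | h
  · rcases lt_or_ge j p with hjp | hpj
    · exact (hp.dvd_choose_of_dvd_of_lt h hj hjp).mul_right _
    · exact (dvd_prod_Icc_add_of_le hp.pos hpj r).mul_left _
  · exact (h.trans (Finset.dvd_prod_of_mem (fun t => r + t)
      (Finset.mem_Icc.mpr ⟨le_rfl, hj⟩))).mul_left _
end

section
/- Let r ≥ 0 and n ≥ 1 be integers. If 𝓛_n^{⟨r⟩}(x) has a monic factor g ∈ ℚ[x] with 1 ≤ deg g ≤ n/2 (equivalently, if 𝓛_n^{⟨r⟩} is reducible over ℚ), then n ≤ r^{π(r)}, where π(r) is the number of primes ≤ r. -/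
open Polynomial

/-- The weight `B · v_p(f_j) + A · j` of the `j`-th coefficient: up to scaling, the height of the
corresponding point of the Newton diagram above the line of slope `-A / B`. -/
noncomputable def coeffWeight (p : ℕ) (A B : ℤ) (f : ℚ[X]) (j : ℕ) : ℤ :=
  B * padicValRat p (f.coeff j) + A * j

/-- `l` is an index of minimal weight among the nonzero coefficients of `f`, and weights are
strictly larger at indices `prec`-below `l`. With `prec` equal to `<` (resp. `>`) this is the left
(resp. right) endpoint of the segment of slope `-A / B` of the Newton polygon. -/
structure IsSegmentEnd (p : ℕ) (A B : ℤ) (prec : ℕ → ℕ → Prop) (f : ℚ[X]) (l : ℕ) : Prop where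
  coeff_ne : f.coeff l ≠ 0
  le : ∀ j, f.coeff j ≠ 0 → coeffWeight p A B f l ≤ coeffWeight p A B f j
  lt : ∀ j, f.coeff j ≠ 0 → prec j l → coeffWeight p A B f l < coeffWeight p A B f j

theorem exists_padicValRat_le_sum {ι : Type*} (p : ℕ) [Fact p.Prime] (s : Finset ι) (F : ι → ℚ)
    (h : ∑ i ∈ s, F i ≠ 0) :
    ∃ i ∈ s, F i ≠ 0 ∧ padicValRat p (F i) ≤ padicValRat p (∑ i ∈ s, F i) := by
  classical
  induction s using Finset.induction_on with
  | empty => simp at h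
  | insert a s ha ih =>
    rw [Finset.sum_insert ha] at h ⊢
    by_cases h1 : F a = 0
    · rw [h1, zero_add] at h ⊢
      obtain ⟨i, hi, h2⟩ := ih h
      exact ⟨i, Finset.mem_insert_of_mem hi, h2⟩
    by_cases h2 : ∑ i ∈ s, F i = 0
    · exact ⟨a, Finset.mem_insert_self _ _, h1, by rw [h2, add_zero]⟩
    obtain ⟨i, hi, h3, h4⟩ := ih h2
    rcases min_le_iff.1 (padicValRat.min_le_padicValRat_add (p := p) h) with h5 | h5
    · exact ⟨a, Finset.mem_insert_self _ _, h1, h5⟩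
    · exact ⟨i, Finset.mem_insert_of_mem hi, h3, h4.trans h5⟩

theorem IsSegmentEnd.mul {p : ℕ} [Fact p.Prime] {A B : ℤ} (hB : 0 < B) {prec : ℕ → ℕ → Prop}
    (hprec : ∀ a b l l', prec (a + b) (l + l') → prec a l ∨ prec b l')
    (hprec' : ∀ a b l l', a + b = l + l' → a ≠ l → prec a l ∨ prec b l')
    {g h : ℚ[X]} {l l' : ℕ} (hg : IsSegmentEnd p A B prec g l) (hh : IsSegmentEnd p A B prec h l') :
    IsSegmentEnd p A B prec (g * h) (l + l') := by
  have key : ∀ a b, g.coeff a ≠ 0 → h.coeff b ≠ 0 →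
      coeffWeight p A B g l + coeffWeight p A B h l' ≤
        coeffWeight p A B g a + coeffWeight p A B h b ∧
      (prec a l ∨ prec b l' → coeffWeight p A B g l + coeffWeight p A B h l' <
        coeffWeight p A B g a + coeffWeight p A B h b) := by
    intro a b ha hb
    have h1 := hg.le a ha
    have h2 := hh.le b hb
    refine ⟨by omega, ?_⟩
    rintro (h3 | h3)
    · have := hg.lt a ha h3
      omega
    · have := hh.lt b hb h3
      omega
  have hmain : (g * h).coeff (l + l') ≠ 0 ∧ padicValRat p ((g * h).coeff (l + l')) =
      padicValRat p (g.coeff l) + padicValRat p (h.coeff l') := by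
    have hne := mul_ne_zero hg.coeff_ne hh.coeff_ne
    rw [← padicValRat.mul hg.coeff_ne hh.coeff_ne, coeff_mul,
      ← Finset.add_sum_erase _ _
        (Finset.HasAntidiagonal.mem_antidiagonal.2 (rfl : (l, l').1 + (l, l').2 = l + l'))]
    set S := ∑ x ∈ (Finset.HasAntidiagonal.antidiagonal (l + l')).erase (l, l'),
      g.coeff x.1 * h.coeff x.2 with hS
    dsimp only
    by_cases h0 : S = 0
    · rw [h0, add_zero]
      exact ⟨hne, rfl⟩
    obtain ⟨⟨a, b⟩, hab, h1, h2⟩ := exists_padicValRat_le_sum p _ _ h0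
    simp only [Finset.mem_erase, Finset.HasAntidiagonal.mem_antidiagonal, ne_eq,
      Prod.mk.injEq] at hab
    have ha := left_ne_zero_of_mul h1
    have hb := right_ne_zero_of_mul h1
    have h3 := (key a b ha hb).2 (hprec' a b l l' hab.2 (by omega))
    have hlt : padicValRat p (g.coeff l * h.coeff l') < padicValRat p S := by
      refine lt_of_lt_of_le ?_ h2
      simp only [coeffWeight] at h3
      rw [padicValRat.mul hg.coeff_ne hh.coeff_ne, padicValRat.mul ha hb]
      refine lt_of_mul_lt_mul_left ?_ hB.le
      have : (a : ℤ) + b = l + l' := by exact_mod_cast hab.2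
      linear_combination h3 + A * this
    have hsum : g.coeff l * h.coeff l' + S ≠ 0 := by
      intro h4
      rw [eq_neg_of_add_eq_zero_left h4, padicValRat.neg] at hlt
      exact lt_irrefl _ hlt
    exact ⟨hsum, padicValRat.add_eq_of_lt hsum hne h0 hlt⟩
  have hw : coeffWeight p A B (g * h) (l + l') =
      coeffWeight p A B g l + coeffWeight p A B h l' := by
    simp only [coeffWeight, hmain.2]
    push_cast
    ring
  have hex : ∀ j, (g * h).coeff j ≠ 0 → ∃ a b, a + b = j ∧ g.coeff a ≠ 0 ∧ h.coeff b ≠ 0 ∧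
      coeffWeight p A B g a + coeffWeight p A B h b ≤ coeffWeight p A B (g * h) j := by
    intro j hj
    rw [coeff_mul] at hj
    obtain ⟨⟨a, b⟩, hab, h1, h2⟩ := exists_padicValRat_le_sum p _ _ hj
    rw [Finset.HasAntidiagonal.mem_antidiagonal] at hab
    have ha := left_ne_zero_of_mul h1
    have hb := right_ne_zero_of_mul h1
    refine ⟨a, b, hab, ha, hb, ?_⟩
    simp only [coeffWeight, coeff_mul g h]
    dsimp only at h2
    rw [padicValRat.mul ha hb] at h2
    have h3 := mul_le_mul_of_nonneg_left h2 hB.le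
    have : (a : ℤ) + b = j := by exact_mod_cast hab
    linear_combination h3 + A * this
  refine ⟨hmain.1, fun j hj => ?_, fun j hj hjl => ?_⟩
  · obtain ⟨a, b, -, ha, hb, h1⟩ := hex j hj
    exact hw ▸ (key a b ha hb).1.trans h1
  · obtain ⟨a, b, rfl, ha, hb, h1⟩ := hex j hj
    exact hw ▸ ((key a b ha hb).2 (hprec a b l l' hjl)).trans_le h1

theorem exists_isSegmentEnd (p : ℕ) (A B : ℤ) (f : ℚ[X]) (hf : f ≠ 0) :
    ∃ l u, IsSegmentEnd p A B (· < ·) f l ∧ IsSegmentEnd p A B (· > ·) f u := by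
  classical
  obtain ⟨m, hm, hmin⟩ := f.support.exists_min_image (coeffWeight p A B f)
    (Polynomial.support_nonempty.2 hf)
  set T := f.support.filter (fun j => coeffWeight p A B f j = coeffWeight p A B f m) with hT
  have hTne : T.Nonempty := ⟨m, by simp [hT, mem_support_iff.1 hm]⟩
  have hTmem : ∀ j, j ∈ T ↔ f.coeff j ≠ 0 ∧ coeffWeight p A B f j = coeffWeight p A B f m := by
    simp [hT]
  obtain ⟨hl0, hl⟩ := (hTmem _).1 (T.min'_mem hTne)
  obtain ⟨hu0, hu⟩ := (hTmem _).1 (T.max'_mem hTne)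
  have hle : ∀ j, f.coeff j ≠ 0 → coeffWeight p A B f m ≤ coeffWeight p A B f j :=
    fun j hj => hmin j (mem_support_iff.2 hj)
  refine ⟨T.min' hTne, T.max' hTne, ⟨hl0, fun j hj => hl ▸ hle j hj, fun j hj hlt => ?_⟩,
    ⟨hu0, fun j hj => hu ▸ hle j hj, fun j hj hlt => ?_⟩⟩
  · rw [hl]
    refine lt_of_le_of_ne (hle j hj) fun h => ?_
    exact (T.min'_le j ((hTmem j).2 ⟨hj, h.symm⟩)).not_gt hlt
  · rw [hu]
    refine lt_of_le_of_ne (hle j hj) fun h => ?_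
    exact (T.le_max' j ((hTmem j).2 ⟨hj, h.symm⟩)).not_gt hlt

theorem IsSegmentEnd.left_le {p : ℕ} {A B : ℤ} {f : ℚ[X]} {l j : ℕ}
    (h : IsSegmentEnd p A B (· < ·) f l) (hj : f.coeff j ≠ 0)
    (hmin : ∀ i, f.coeff i ≠ 0 → coeffWeight p A B f j ≤ coeffWeight p A B f i) : l ≤ j := by
  by_contra! hlt
  exact (h.lt j hj hlt).not_ge (hmin l h.coeff_ne)

theorem IsSegmentEnd.le_right {p : ℕ} {A B : ℤ} {f : ℚ[X]} {u j : ℕ}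
    (h : IsSegmentEnd p A B (· > ·) f u) (hj : f.coeff j ≠ 0)
    (hmin : ∀ i, f.coeff i ≠ 0 → coeffWeight p A B f j ≤ coeffWeight p A B f i) : j ≤ u := by
  by_contra! hlt
  exact (h.lt j hj hlt).not_ge (hmin u h.coeff_ne)

/-- The horizontal length of a segment of slope `-A / B` is a multiple of `B`. -/
theorem IsSegmentEnd.dvd_sub {p : ℕ} {A B : ℤ} (hAB : IsCoprime A B) {f : ℚ[X]} {l u : ℕ}
    {prec prec' : ℕ → ℕ → Prop}
    (hl : IsSegmentEnd p A B prec f l) (hu : IsSegmentEnd p A B prec' f u) :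
    B ∣ (u : ℤ) - l := by
  have h := le_antisymm (hl.le u hu.coeff_ne) (hu.le l hl.coeff_ne)
  simp only [coeffWeight] at h
  refine hAB.symm.dvd_of_dvd_mul_left (Dvd.intro
    (padicValRat p (f.coeff l) - padicValRat p (f.coeff u)) ?_)
  linear_combination h

/-- Segments of a Newton polygon are ordered by slope. -/
theorem IsSegmentEnd.le_of_slope_lt {p : ℕ} {A B A' B' : ℤ} (hB : 0 < B) (hB' : 0 < B')
    (hslope : A * B' < A' * B) {f : ℚ[X]} {l u : ℕ} {prec prec' : ℕ → ℕ → Prop}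
    (hu : IsSegmentEnd p A' B' prec f u) (hl : IsSegmentEnd p A B prec' f l) : u ≤ l := by
  have h1 := hu.le l hl.coeff_ne
  have h2 := hl.le u hu.coeff_ne
  simp only [coeffWeight] at h1 h2
  by_contra! hlt
  have hlt' : (0 : ℤ) < (u : ℤ) - l := sub_pos.2 (by exact_mod_cast hlt)
  nlinarith [mul_le_mul_of_nonneg_left h1 hB.le, mul_le_mul_of_nonneg_left h2 hB'.le,
    mul_pos (sub_pos.2 hslope) hlt']

theorem not_dvd_choose_of_pow_dvd {p m Q y : ℕ} [hp : Fact p.Prime] (hQ : p ^ m ∣ Q)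
    (hy : y < p ^ m) : ¬ p ∣ (Q + y).choose y := by
  have hne : (Q + y).choose y ≠ 0 := (Nat.choose_pos (Nat.le_add_left _ _)).ne'
  rw [dvd_iff_padicValNat_ne_zero hne, not_not, padicValNat_choose' (Nat.lt_succ_self _),
    Finset.card_eq_zero, Finset.filter_eq_empty_iff]
  intro i _
  rw [not_le]
  rcases le_total i m with h | h
  · rw [Nat.mod_eq_zero_of_dvd ((pow_dvd_pow p h).trans hQ), add_zero]
    exact Nat.mod_lt _ (pow_pos hp.out.pos _)
  · have hlt : y < p ^ i := hy.trans_le (Nat.pow_le_pow_right hp.out.pos h)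
    rw [Nat.mod_eq_of_lt hlt]
    obtain ⟨c, hc⟩ := (Nat.dvd_mod_iff (pow_dvd_pow p h)).2 hQ
    obtain ⟨d, hd⟩ := pow_dvd_pow p h
    have h1 := Nat.mod_lt Q (pow_pos hp.out.pos i)
    rw [hc, hd] at h1 ⊢
    have h2 : c < d := lt_of_mul_lt_mul_left h1 (Nat.zero_le _)
    calc y + p ^ m * c < p ^ m + p ^ m * c := by omega
      _ = p ^ m * (c + 1) := by ring
      _ ≤ p ^ m * d := Nat.mul_le_mul_left _ h2

theorem padicValNat_factorial_add {p a b : ℕ} [hp : Fact p.Prime] (h : ¬ p ∣ (a + b).choose b) :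
    padicValNat p (a + b).factorial = padicValNat p a.factorial + padicValNat p b.factorial := by
  have hne : (a + b).choose b ≠ 0 := (Nat.choose_pos (Nat.le_add_left _ _)).ne'
  have h1 := Nat.choose_mul_factorial_mul_factorial (Nat.le_add_left b a)
  rw [Nat.add_sub_cancel] at h1
  rw [← h1, padicValNat.mul (mul_ne_zero hne (Nat.factorial_ne_zero _)) (Nat.factorial_ne_zero _),
    padicValNat.mul hne (Nat.factorial_ne_zero _), padicValNat.eq_zero_of_not_dvd h]
  omega

/-- The repunit `1 + p + ⋯ + p ^ (i - 1)`. -/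
def repunit (p i : ℕ) : ℕ := ∑ l ∈ Finset.range i, p ^ l

theorem repunit_succ (p i : ℕ) : repunit p (i + 1) = repunit p i + p ^ i :=
  Finset.sum_range_succ _ _

theorem repunit_succ' (p i : ℕ) : repunit p (i + 1) = p * repunit p i + 1 := by
  simp [repunit, Finset.sum_range_succ', Finset.mul_sum, pow_succ']

theorem isCoprime_repunit (p i : ℕ) : IsCoprime (repunit p i : ℤ) ((p ^ i : ℕ) : ℤ) := by
  cases i with
  | zero => simpa using isCoprime_one_right
  | succ i =>
    push_cast
    refine IsCoprime.pow_right ⟨1, -repunit p i, ?_⟩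
    rw [repunit_succ']
    push_cast
    ring

theorem padicValNat_factorial_pow_mul (p i q : ℕ) [hp : Fact p.Prime] :
    padicValNat p (p ^ i * q).factorial = repunit p i * q + padicValNat p q.factorial := by
  induction i with
  | zero => simp [repunit]
  | succ i ih =>
    rw [pow_succ', mul_assoc, padicValNat_factorial_mul, ih, repunit_succ]
    ring

/-- The height of the point `(y, -v_p(y!))` above the line through the origin of slope
`-v_p((p ^ i)!) / p ^ i`, multiplied by `p ^ i`. -/
noncomputable def factorialHeight (p i y : ℕ) : ℤ :=
  repunit p i * y - p ^ i * padicValNat p y.factorial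

theorem factorialHeight_add {p i a b : ℕ} [Fact p.Prime] (h : ¬ p ∣ (a + b).choose b) :
    factorialHeight p i (a + b) = factorialHeight p i a + factorialHeight p i b := by
  simp only [factorialHeight, padicValNat_factorial_add h]
  push_cast
  ring

theorem factorialHeight_pow_mul (p i q : ℕ) [Fact p.Prime] :
    factorialHeight p i (p ^ i * q) = -(p ^ i * padicValNat p q.factorial) := by
  simp only [factorialHeight, padicValNat_factorial_pow_mul]
  push_cast
  ring

theorem factorialHeight_nonneg {p i y : ℕ} [hp : Fact p.Prime] (hy : y < p ^ i) :
    0 ≤ factorialHeight p i y := by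
  rcases Nat.eq_zero_or_pos y with rfl | hpos
  · simp [factorialHeight]
  have h1 := sub_one_mul_padicValNat_factorial_lt_of_ne_zero (p := p) hpos.ne'
  have hp1 : (1 : ℤ) < p := by exact_mod_cast hp.out.one_lt
  have h2 : ((p : ℤ) - 1) * padicValNat p y.factorial + 1 ≤ y := by
    have : (((p - 1 : ℕ) : ℤ)) * padicValNat p y.factorial < y := by exact_mod_cast h1
    rw [Nat.cast_sub hp.out.one_lt.le, Nat.cast_one] at this
    exact this
  have h3 : (repunit p i : ℤ) * (p - 1) = p ^ i - 1 := by
    have := geom_sum_mul (p : ℤ) i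
    simpa [repunit] using this
  have h4 : (y : ℤ) ≤ p ^ i := by exact_mod_cast hy.le
  have h5 : (0 : ℤ) ≤ (p - 1) * factorialHeight p i y := by
    have hpow : (0 : ℤ) ≤ p ^ i := by positivity
    have := mul_le_mul_of_nonneg_left h2 hpow
    simp only [factorialHeight]
    linear_combination this + h4 - y * h3
  exact nonneg_of_mul_nonneg_right h5 (by omega)

theorem factorialHeight_min {p i n y : ℕ} [hp : Fact p.Prime] (hy : y ≤ n) :
    factorialHeight p i (p ^ i * (n / p ^ i)) ≤ factorialHeight p i y := by
  have hlt := Nat.mod_lt y (pow_pos hp.out.pos i)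
  have h := factorialHeight_add (i := i)
    (not_dvd_choose_of_pow_dvd (Dvd.intro (y / p ^ i) rfl) hlt)
  rw [Nat.div_add_mod] at h
  have h1 := factorialHeight_nonneg hlt
  have h2 : padicValNat p (y / p ^ i).factorial ≤ padicValNat p (n / p ^ i).factorial :=
    (padicValNat_dvd_iff_le (Nat.factorial_ne_zero _)).1
      (pow_padicValNat_dvd.trans (Nat.factorial_dvd_factorial (Nat.div_le_div_right hy)))
  rw [h, factorialHeight_pow_mul, factorialHeight_pow_mul]
  have h3 : (p : ℤ) ^ i * padicValNat p (y / p ^ i).factorial ≤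
      p ^ i * padicValNat p (n / p ^ i).factorial := by
    gcongr
  omega

theorem factorialHeight_truncate_succ (p i n : ℕ) [hp : Fact p.Prime] :
    factorialHeight p i (p ^ (i + 1) * (n / p ^ (i + 1))) =
      factorialHeight p i (p ^ i * (n / p ^ i)) := by
  rw [pow_succ, mul_assoc, ← Nat.div_div_eq_div_mul, factorialHeight_pow_mul,
    factorialHeight_pow_mul]
  conv_rhs => rw [← Nat.div_add_mod (n / p ^ i) p]
  rw [padicValNat_factorial_mul_add _ (Nat.mod_lt _ hp.out.pos)]

theorem laguerreL_coeff {n r j : ℕ} (hj : j ≤ n) :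
    (laguerreL n r).coeff j * j.factorial = n.factorial * (n - j + r).choose r := by
  have hprod : ∀ d : ℕ, (∏ t ∈ Finset.Icc 1 d, ((r : ℚ) + t)) * r.factorial =
      (d + r).factorial := by
    intro d
    induction d with
    | zero => simp
    | succ d ih =>
      rw [Finset.prod_Icc_succ_top (by omega), mul_right_comm, ih,
        show d + 1 + r = (d + r) + 1 by ring, Nat.factorial_succ]
      push_cast
      ring
  have hcoeff : (laguerreL n r).coeff j =
      (n.choose j : ℚ) * ∏ t ∈ Finset.Icc 1 (n - j), ((r : ℚ) + (t : ℚ)) := by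
    simp only [laguerreL, finsetSum_coeff, coeff_C_mul_X_pow]
    rw [Finset.sum_ite_eq, if_pos (by simpa [Nat.lt_succ_iff] using hj)]
  have h1 : (n.choose j : ℚ) * j.factorial * (n - j).factorial = n.factorial := by
    exact_mod_cast Nat.choose_mul_factorial_mul_factorial hj
  have h2 : ((n - j + r).choose r : ℚ) * r.factorial * (n - j).factorial =
      (n - j + r).factorial := by
    have := Nat.choose_mul_factorial_mul_factorial (Nat.le_add_left r (n - j))
    rw [Nat.add_sub_cancel] at this
    exact_mod_cast this
  have h3 := hprod (n - j)
  have hr : (r.factorial : ℚ) ≠ 0 := by exact_mod_cast r.factorial_ne_zero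
  have hnj : ((n - j).factorial : ℚ) ≠ 0 := by exact_mod_cast (n - j).factorial_ne_zero
  rw [hcoeff]
  refine mul_right_cancel₀ hr (mul_right_cancel₀ hnj ?_)
  rw [mul_assoc (n.factorial : ℚ), mul_assoc (n.factorial : ℚ), h2, ← h3, ← h1]
  ring

theorem laguerreL_coeff_ne_zero {n r j : ℕ} (hj : j ≤ n) : (laguerreL n r).coeff j ≠ 0 := by
  intro h
  have h1 := laguerreL_coeff (r := r) hj
  rw [h, zero_mul] at h1
  have h2 : n.factorial * (n - j + r).choose r ≠ 0 :=
    mul_ne_zero n.factorial_ne_zero (Nat.choose_pos (Nat.le_add_left _ _)).ne'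
  exact h2 (by exact_mod_cast h1.symm)

theorem laguerreL_coeff_eq_zero {n r j : ℕ} (hj : n < j) : (laguerreL n r).coeff j = 0 := by
  simp only [laguerreL, finsetSum_coeff, coeff_C_mul_X_pow]
  rw [Finset.sum_ite_eq, if_neg (by simpa using hj)]

theorem laguerreL_natDegree (n r : ℕ) : (laguerreL n r).natDegree = n :=
  natDegree_eq_of_le_of_coeff_ne_zero
    (natDegree_le_iff_coeff_eq_zero.2 fun _ h => laguerreL_coeff_eq_zero h)
    (laguerreL_coeff_ne_zero le_rfl)

theorem coeffWeight_laguerreL {p i n r j : ℕ} [Fact p.Prime] (hj : j ≤ n) :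
    coeffWeight p (repunit p i) (p ^ i : ℕ) (laguerreL n r) j =
      p ^ i * padicValNat p n.factorial + (p ^ i * padicValNat p ((n - j + r).choose r) +
        factorialHeight p i j) := by
  have h := congrArg (padicValRat p) (laguerreL_coeff (r := r) hj)
  rw [padicValRat.mul (laguerreL_coeff_ne_zero hj) (by exact_mod_cast j.factorial_ne_zero),
    padicValRat.mul (by exact_mod_cast n.factorial_ne_zero)
      (by exact_mod_cast (Nat.choose_pos (Nat.le_add_left r (n - j))).ne'),
    padicValRat.of_nat, padicValRat.of_nat, padicValRat.of_nat] at h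
  simp only [coeffWeight, factorialHeight, Nat.cast_pow]
  linear_combination (p : ℤ) ^ i * h

theorem choose_mul_choose_add (N r y : ℕ) :
    (y + r).choose r * (N + r).choose (y + r) = (N + r).choose r * N.choose y := by
  have := Nat.choose_mul (n := N + r) (k := y + r) (s := r) (show r ≤ y + r by omega)
  rw [Nat.add_sub_cancel, Nat.add_sub_cancel] at this
  rw [mul_comm, this]

theorem not_dvd_choose_mod {p m n : ℕ} [hp : Fact p.Prime] : ¬ p ∣ n.choose (n % p ^ m) := by
  have := not_dvd_choose_of_pow_dvd (p := p) (Dvd.intro (n / p ^ m) rfl)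
    (Nat.mod_lt n (pow_pos hp.out.pos m))
  rwa [Nat.div_add_mod] at this

/-- Each coefficient of `𝓛_n` lies above the Minkowski sum of the Newton diagram of `𝓛_b`, where
`b = n % p ^ m`, and the Newton polygon of the truncated exponential of degree `n - b`. -/
theorem exists_height_le (p m i n r j : ℕ) [hp : Fact p.Prime] (hj : j ≤ n) :
    ∃ x ≤ n % p ^ m, (p ^ i * padicValNat p ((n % p ^ m - x + r).choose r) + factorialHeight p i x) +
      factorialHeight p i (p ^ i * (n / p ^ i)) ≤
      p ^ i * padicValNat p ((n - j + r).choose r) + factorialHeight p i j := by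
  set b := n % p ^ m with hb
  have hvand : ¬ p ∣ ∑ x ∈ Finset.HasAntidiagonal.antidiagonal b,
      j.choose x.1 * (n - j).choose x.2 := by
    rw [← Nat.add_choose_eq, Nat.add_sub_cancel' hj]
    exact not_dvd_choose_mod
  obtain ⟨⟨x, y⟩, hxy, hnd⟩ : ∃ x ∈ Finset.HasAntidiagonal.antidiagonal b,
      ¬ p ∣ j.choose x.1 * (n - j).choose x.2 := by
    by_contra! hcon
    exact hvand (Finset.dvd_sum hcon)
  rw [Finset.HasAntidiagonal.mem_antidiagonal] at hxy
  dsimp only at hxy hnd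
  have hx : ¬ p ∣ j.choose x := fun h => hnd (h.mul_right _)
  have hy : ¬ p ∣ (n - j).choose y := fun h => hnd (h.mul_left _)
  have hxj : x ≤ j := by
    by_contra! hlt
    exact hx (by simp [Nat.choose_eq_zero_of_lt hlt])
  have hyj : y ≤ n - j := by
    by_contra! hlt
    exact hy (by simp [Nat.choose_eq_zero_of_lt hlt])
  refine ⟨x, by omega, ?_⟩
  have hbx : b - x = y := by omega
  rw [hbx]
  have hval : padicValNat p ((y + r).choose r) ≤ padicValNat p ((n - j + r).choose r) := by
    have h1 := congrArg (padicValNat p) (choose_mul_choose_add (n - j) r y)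
    rw [padicValNat.mul (Nat.choose_pos (by omega)).ne' (Nat.choose_pos (by omega)).ne',
      padicValNat.mul (Nat.choose_pos (by omega)).ne' (Nat.choose_pos hyj).ne',
      padicValNat.eq_zero_of_not_dvd hy] at h1
    omega
  have hsplit : factorialHeight p i j = factorialHeight p i (j - x) + factorialHeight p i x := by
    rw [← factorialHeight_add (by rwa [Nat.sub_add_cancel hxj]), Nat.sub_add_cancel hxj]
  have hmin := factorialHeight_min (p := p) (i := i) (show j - x ≤ n by omega)
  have h3 : (p : ℤ) ^ i * padicValNat p ((y + r).choose r) ≤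
      p ^ i * padicValNat p ((n - j + r).choose r) := by gcongr
  omega

theorem height_add_eq {p m i n r P x : ℕ} [hp : Fact p.Prime] (hr : n % p ^ m + r < p ^ m)
    (hP : p ^ m ∣ P) (hPn : P ≤ n) (hx : x ≤ n % p ^ m) :
    P + x ≤ n ∧ p ^ i * padicValNat p ((n - (P + x) + r).choose r) + factorialHeight p i (P + x) =
      (p ^ i * padicValNat p ((n % p ^ m - x + r).choose r) + factorialHeight p i x) +
      factorialHeight p i P := by
  set b := n % p ^ m with hb
  obtain ⟨c, rfl⟩ := hP
  have hn : p ^ m * (n / p ^ m) + b = n := Nat.div_add_mod n _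
  have hc : c ≤ n / p ^ m := by
    rw [Nat.le_div_iff_mul_le (pow_pos hp.out.pos m), mul_comm]
    exact hPn
  obtain ⟨d, hd⟩ := Nat.exists_eq_add_of_le hc
  rw [hd, mul_add] at hn
  have hN : n - (p ^ m * c + x) = p ^ m * d + (b - x) := by omega
  refine ⟨by omega, ?_⟩
  rw [factorialHeight_add (not_dvd_choose_of_pow_dvd (Dvd.intro c rfl) (show x < p ^ m by omega)),
    hN]
  have h1 := congrArg (padicValNat p)
    (choose_mul_choose_add (p ^ m * d + (b - x)) r (b - x))
  have h2 : ¬ p ∣ (p ^ m * d + (b - x)).choose (b - x) :=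
    not_dvd_choose_of_pow_dvd (Dvd.intro d rfl) (by omega)
  have h3 : ¬ p ∣ (p ^ m * d + (b - x) + r).choose (b - x + r) := by
    rw [add_assoc]
    exact not_dvd_choose_of_pow_dvd (Dvd.intro d rfl) (by omega)
  rw [padicValNat.mul (Nat.choose_pos (by omega)).ne' (Nat.choose_pos (by omega)).ne',
    padicValNat.mul (Nat.choose_pos (by omega)).ne' (Nat.choose_pos (by omega)).ne',
    padicValNat.eq_zero_of_not_dvd h2, padicValNat.eq_zero_of_not_dvd h3, add_zero, add_zero] at h1
  rw [h1]
  ring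

/-- The segment of slope `-v_p((p ^ i)!) / p ^ i` of the Newton polygon of `𝓛_n` is at least as long
as the one of the truncated exponential of degree `n`. -/
theorem laguerreL_segment_length {p m i n r l u : ℕ} [hp : Fact p.Prime]
    (hr : n % p ^ m + r < p ^ m) (hi : m ≤ i)
    (hl : IsSegmentEnd p (repunit p i) (p ^ i : ℕ) (· < ·) (laguerreL n r) l)
    (hu : IsSegmentEnd p (repunit p i) (p ^ i : ℕ) (· > ·) (laguerreL n r) u) :
    (p ^ i * (n / p ^ i : ℕ) : ℤ) - p ^ (i + 1) * (n / p ^ (i + 1) : ℕ) ≤ u - l := by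
  obtain ⟨x, hx, hxmin⟩ := (Finset.range (n % p ^ m + 1)).exists_min_image
    (fun x => (p ^ i * padicValNat p ((n % p ^ m - x + r).choose r) + factorialHeight p i x : ℤ))
    ⟨0, by simp⟩
  simp only [Finset.mem_range, Nat.lt_succ_iff] at hx hxmin
  have key : ∀ P, p ^ m ∣ P → P ≤ n →
      factorialHeight p i P = factorialHeight p i (p ^ i * (n / p ^ i)) →
      (laguerreL n r).coeff (P + x) ≠ 0 ∧ ∀ j, (laguerreL n r).coeff j ≠ 0 →
        coeffWeight p (repunit p i) (p ^ i : ℕ) (laguerreL n r) (P + x) ≤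
          coeffWeight p (repunit p i) (p ^ i : ℕ) (laguerreL n r) j := by
    intro P hP hPn hPh
    obtain ⟨h1, h2⟩ := height_add_eq (i := i) hr hP hPn hx
    refine ⟨laguerreL_coeff_ne_zero h1, fun j hj => ?_⟩
    have hjn : j ≤ n := by
      by_contra! hlt
      exact hj (laguerreL_coeff_eq_zero hlt)
    rw [coeffWeight_laguerreL h1, coeffWeight_laguerreL hjn, h2, hPh]
    obtain ⟨y, hy, hyle⟩ := exists_height_le p m i n r j hjn
    have := hxmin y hy
    omega
  have hdvd : ∀ e q, m ≤ e → p ^ m ∣ p ^ e * q := fun e q he => (pow_dvd_pow p he).mul_right _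
  obtain ⟨a1, a2⟩ := key (p ^ (i + 1) * (n / p ^ (i + 1))) (hdvd _ _ (by omega))
    (Nat.mul_div_le _ _) (factorialHeight_truncate_succ p i n)
  obtain ⟨b1, b2⟩ := key (p ^ i * (n / p ^ i)) (hdvd _ _ hi) (Nat.mul_div_le _ _) rfl
  have hl' := hl.left_le a1 a2
  have hu' := hu.le_right b1 b2
  have hl'' : (l : ℤ) ≤ p ^ (i + 1) * (n / p ^ (i + 1) : ℕ) + x := by exact_mod_cast hl'
  have hu'' : (p ^ i * (n / p ^ i : ℕ) : ℤ) + x ≤ u := by exact_mod_cast hu'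
  push_cast at hl'' hu'' ⊢
  linarith

theorem sum_segment_length_le {p m : ℕ} [hp : Fact p.Prime] {h : ℚ[X]} {l u : ℕ → ℕ}
    (hl : ∀ i, IsSegmentEnd p (repunit p i) (p ^ i : ℕ) (· < ·) h (l i))
    (hu : ∀ i, IsSegmentEnd p (repunit p i) (p ^ i : ℕ) (· > ·) h (u i)) (t : ℕ) :
    ∑ i ∈ Finset.Ico m (m + t), ((u i : ℤ) - l i) ≤ h.natDegree := by
  have hpos : ∀ i, (0 : ℤ) < (p ^ i : ℕ) := fun i => by exact_mod_cast pow_pos hp.out.pos i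
  have hstep : ∀ i, u (i + 1) ≤ l i := fun i => by
    refine (hu (i + 1)).le_of_slope_lt (hpos i) (hpos (i + 1)) ?_ (hl i)
    rw [repunit_succ', pow_succ]
    have := hpos i
    push_cast at this ⊢
    linarith
  have hanti : ∑ i ∈ Finset.Ico m (m + t), ((u i : ℤ) - l i) + u (m + t) ≤ u m := by
    induction t with
    | zero => simp
    | succ t ih =>
      rw [← add_assoc, Finset.sum_Ico_succ_top (by omega)]
      have := hstep (m + t)
      omega
  have := le_natDegree_of_ne_zero (hu m).coeff_ne
  omega

/-- If adding `r` to `n` in base `p` produces no carry out of the `m` lowest digits, and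
`r < p ^ m`, then the degree of a factor of `𝓛_n` is at most `n` modulo `p ^ m`. -/
theorem natDegree_mod_le_of_dvd_laguerreL {p m n r : ℕ} [hp : Fact p.Prime]
    (hr : n % p ^ m + r < p ^ m) {g : ℚ[X]} (hg : g ∣ laguerreL n r) :
    g.natDegree % p ^ m ≤ n % p ^ m := by
  obtain ⟨h, hgh⟩ := hg
  have hf0 : laguerreL n r ≠ 0 := fun h0 =>
    laguerreL_coeff_ne_zero (r := r) (le_refl n) (by rw [h0, coeff_zero])
  have hg0 : g ≠ 0 := by
    rintro rfl
    exact hf0 (by rw [hgh, zero_mul])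
  have hh0 : h ≠ 0 := by
    rintro rfl
    exact hf0 (by rw [hgh, mul_zero])
  have hdeg : g.natDegree + h.natDegree = n := by
    rw [← natDegree_mul hg0 hh0, ← hgh, laguerreL_natDegree]
  choose lg ug hlg hug using fun i => exists_isSegmentEnd p (repunit p i) (p ^ i : ℕ) g hg0
  choose lh uh hlh huh using fun i => exists_isSegmentEnd p (repunit p i) (p ^ i : ℕ) h hh0
  have hpos : ∀ i, (0 : ℤ) < (p ^ i : ℕ) := fun i => by exact_mod_cast pow_pos hp.out.pos i
  have hlen : ∀ i, m ≤ i → (p ^ i * (n / p ^ i : ℕ) : ℤ) - p ^ (i + 1) * (n / p ^ (i + 1) : ℕ) ≤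
      ((ug i : ℤ) - lg i) + ((uh i : ℤ) - lh i) := by
    intro i hi
    have h1 := (hlg i).mul (hpos i) (by intros; omega) (by intros; omega) (hlh i)
    have h2 := (hug i).mul (hpos i) (by intros; omega) (by intros; omega) (huh i)
    rw [← hgh] at h1 h2
    have h3 := laguerreL_segment_length hr hi h1 h2
    push_cast at h3 ⊢
    linarith
  have htele : ∀ t, ∑ i ∈ Finset.Ico m (m + t),
      ((p ^ i * (n / p ^ i : ℕ) : ℤ) - p ^ (i + 1) * (n / p ^ (i + 1) : ℕ)) =
      p ^ m * (n / p ^ m : ℕ) - p ^ (m + t) * (n / p ^ (m + t) : ℕ) := by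
    intro t
    induction t with
    | zero => simp
    | succ t ih =>
      rw [← add_assoc, Finset.sum_Ico_succ_top (by omega), ih]
      ring
  have hbig : n / p ^ (m + n) = 0 :=
    Nat.div_eq_of_lt ((Nat.lt_pow_self hp.out.one_lt).trans_le
      (Nat.pow_le_pow_right hp.out.pos (Nat.le_add_left _ _)))
  have hsum := Finset.sum_le_sum fun i (hi : i ∈ Finset.Ico m (m + n)) =>
    hlen i (Finset.mem_Ico.1 hi).1
  rw [htele, hbig, Finset.sum_add_distrib] at hsum
  have hgle := sum_segment_length_le (m := m) hlg hug n
  have hhle := sum_segment_length_le (m := m) hlh huh n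
  obtain ⟨c, hc⟩ : ((p ^ m : ℕ) : ℤ) ∣ ∑ i ∈ Finset.Ico m (m + n), ((ug i : ℤ) - lg i) := by
    refine Finset.dvd_sum fun i hi => ?_
    refine dvd_trans ?_ ((hlg i).dvd_sub (isCoprime_repunit p i) (hug i))
    exact_mod_cast pow_dvd_pow p (Finset.mem_Ico.1 hi).1
  have hn : (p ^ m * (n / p ^ m : ℕ) : ℤ) + (n % p ^ m : ℕ) = n := by
    exact_mod_cast Nat.div_add_mod n (p ^ m)
  have hlt := Nat.mod_lt n (pow_pos hp.out.pos m)
  rw [hc] at hgle hsum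
  push_cast at hgle hsum hn
  have hcast : (g.natDegree : ℤ) % (p ^ m : ℕ) ≤ (n % p ^ m : ℕ) := by
    have h1 : (g.natDegree : ℤ) - p ^ m * c ≤ (n % p ^ m : ℕ) := by
      have h0 : (g.natDegree : ℤ) + h.natDegree = n := by exact_mod_cast hdeg
      push_cast
      linarith
    have h2 : (0 : ℤ) ≤ g.natDegree - p ^ m * c := by linarith
    have h3 : (g.natDegree : ℤ) - p ^ m * c < (p ^ m : ℕ) :=
      h1.trans_lt (by exact_mod_cast hlt)
    rw [← Int.sub_mul_emod_self_left _ _ c]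
    push_cast at h3 ⊢
    rw [Int.emod_eq_of_lt h2 h3]
    exact_mod_cast h1
  exact_mod_cast hcast

/-- The least common multiple of `1, …, N`, as a product of prime powers. -/
def lcmUpTo (N : ℕ) : ℕ := ∏ p ∈ Nat.primesLE N, p ^ Nat.log p N

theorem lcmUpTo_ne_zero (N : ℕ) : lcmUpTo N ≠ 0 :=
  Finset.prod_ne_zero_iff.2 fun _ hp => pow_ne_zero _ (Nat.mem_primesLE.1 hp).2.ne_zero

theorem lcmUpTo_le (N : ℕ) : lcmUpTo N ≤ N ^ Nat.primeCounting N := by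
  rw [← Nat.primesLE_card_eq_primeCounting]
  refine Finset.prod_le_pow_card _ _ _ fun p hp => Nat.pow_log_le_self _ ?_
  have := Nat.mem_primesLE.1 hp
  exact (this.2.pos.trans_le this.1).ne'

theorem log_le_factorization_lcmUpTo {p : ℕ} (hp : p.Prime) (N : ℕ) :
    Nat.log p N ≤ (lcmUpTo N).factorization p := by
  rcases lt_or_ge N p with h | h
  · simp [Nat.log_of_lt h]
  rw [← hp.pow_dvd_iff_le_factorization (lcmUpTo_ne_zero N)]
  exact Finset.dvd_prod_of_mem (fun p => p ^ Nat.log p N) (Nat.mem_primesLE.2 ⟨h, hp⟩)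

theorem le_pow_primeCounting {n r : ℕ} (hn : n ≠ 0) (hr : r ≠ 0)
    (h : ∀ p, p.Prime → p ^ n.factorization p ≤ r) : n ≤ r ^ Nat.primeCounting r := by
  have hsub : n.primeFactors ⊆ Nat.primesLE r := by
    intro p hp
    have hp1 := Nat.prime_of_mem_primeFactors hp
    refine Nat.mem_primesLE.2 ⟨(Nat.le_self_pow ?_ p).trans (h p hp1), hp1⟩
    exact (hp1.factorization_pos_of_dvd hn (Nat.dvd_of_mem_primeFactors hp)).ne'
  calc n = ∏ p ∈ n.primeFactors, p ^ n.factorization p :=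
        (Nat.prod_factorization_pow_eq_self hn).symm
    _ ≤ r ^ n.primeFactors.card :=
        Finset.prod_le_pow_card _ _ _ fun p hp => h p (Nat.prime_of_mem_primeFactors hp)
    _ ≤ r ^ (Nat.primesLE r).card :=
        Nat.pow_le_pow_right (Nat.pos_of_ne_zero hr) (Finset.card_le_card hsub)
    _ = _ := by rw [Nat.primesLE_card_eq_primeCounting]

theorem choose_le_choose_of_le_half {n a b : ℕ} (hab : a ≤ b) (hb : 2 * b ≤ n) :
    n.choose a ≤ n.choose b := by
  induction b, hab using Nat.le_induction with
  | base => exact le_rfl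
  | succ b _ ih => exact (ih (by omega)).trans (Nat.choose_le_succ_of_lt_half_left (by omega))

/-- The property of the degree `k` of a factor of `𝓛_n` given by
`natDegree_mod_le_of_dvd_laguerreL`. -/
def ModLe (n r k : ℕ) : Prop :=
  ∀ p m : ℕ, p.Prime → n % p ^ m + r < p ^ m → k % p ^ m ≤ n % p ^ m

theorem le_pow_primeCounting_of_le {n r k : ℕ} (h : ModLe n r k) (hk : 1 ≤ k) (hn : n ≠ 0)
    (hkr : k ≤ r) : n ≤ r ^ Nat.primeCounting r := by
  refine le_pow_primeCounting hn (by omega) fun p hp => ?_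
  by_contra! hlt
  have h1 : n % p ^ n.factorization p = 0 := Nat.mod_eq_zero_of_dvd (Nat.ordProj_dvd n p)
  have h2 := h p _ hp (by rwa [h1, zero_add])
  rw [h1, Nat.le_zero] at h2
  have := Nat.le_of_dvd hk (Nat.dvd_of_mod_eq_zero h2)
  omega

theorem lt_of_carry {q n k : ℕ} (hq : 0 < q) (hkn : k ≤ n)
    (hc : q ≤ k % q + (n - k) % q) : n % q < k % q := by
  have h1 := Nat.mod_lt k hq
  have h2 := Nat.mod_lt (n - k) hq
  have h3 : n % q = k % q + (n - k) % q - q := by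
    conv_lhs => rw [← Nat.add_sub_cancel' hkn, Nat.add_mod, Nat.mod_eq_sub_mod hc]
    exact Nat.mod_eq_of_lt (by omega)
  omega

theorem ModLe.choose_dvd {n r k : ℕ} (h : ModLe n r k) (hkn : k ≤ n) :
    n.choose k ∣ lcmUpTo r * (n + r).choose r := by
  have hne : (n + r).choose r ≠ 0 := (Nat.choose_pos (Nat.le_add_left _ _)).ne'
  rw [← Nat.factorization_prime_le_iff_dvd (Nat.choose_pos hkn).ne'
    (mul_ne_zero (lcmUpTo_ne_zero r) hne)]
  intro p hp
  have hlog : Nat.log p n < Nat.log p (n + r) + 1 :=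
    Nat.lt_succ_of_le (Nat.log_mono_right (Nat.le_add_right _ _))
  rw [Nat.factorization_mul (lcmUpTo_ne_zero r) hne, Finsupp.add_apply,
    Nat.factorization_choose hp hkn hlog, Nat.factorization_choose' hp (Nat.lt_succ_self _)]
  refine le_trans ?_ (Nat.add_le_add_right (log_le_factorization_lcmUpTo hp r) _)
  rw [← Nat.add_sub_cancel (Nat.log p r) 1, ← Nat.card_Ico 1]
  refine (Finset.card_le_card fun m hm => ?_).trans (Finset.card_union_le _ _)
  simp only [Finset.mem_filter, Finset.mem_union, Finset.mem_Ico] at hm ⊢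
  rcases Nat.lt_or_ge r (p ^ m) with hr | hr
  · refine Or.inr ⟨hm.1, ?_⟩
    have h1 := lt_of_carry (pow_pos hp.pos m) hkn hm.2
    rw [Nat.mod_eq_of_lt hr]
    by_contra! h2
    have := h p m hp (by omega)
    omega
  · refine Or.inl ⟨hm.1.1, Nat.lt_succ_of_le ?_⟩
    exact Nat.le_log_of_pow_le hp.one_lt hr

theorem ModLe.choose_dvd_lcmUpTo {n r k : ℕ} (h : ModLe n r k) (hr : 1 ≤ r)
    (hkn : k ≤ n) : n.choose k ∣ lcmUpTo (k + r - 1) := by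
  rw [← Nat.factorization_prime_le_iff_dvd (Nat.choose_pos hkn).ne' (lcmUpTo_ne_zero _)]
  intro p hp
  rw [Nat.factorization_choose hp hkn (Nat.lt_succ_self _)]
  refine le_trans ?_ (log_le_factorization_lcmUpTo hp _)
  rw [← Nat.add_sub_cancel (Nat.log p (k + r - 1)) 1, ← Nat.card_Ico 1]
  refine Finset.card_le_card fun m hm => ?_
  simp only [Finset.mem_filter, Finset.mem_Ico] at hm ⊢
  refine ⟨hm.1.1, Nat.lt_succ_of_le (Nat.le_log_of_pow_le hp.one_lt ?_)⟩
  by_contra! hlt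
  have h1 := lt_of_carry (pow_pos hp.pos m) hkn hm.2
  rw [Nat.mod_eq_of_lt (show k < p ^ m by omega)] at h1
  have h2 := h p m hp (by omega)
  rw [Nat.mod_eq_of_lt (show k < p ^ m by omega)] at h2
  omega

theorem primeCounting_two_mul_le {r : ℕ} (hr : 1 ≤ r) : Nat.primeCounting (2 * r) ≤ r := by
  induction r, hr using Nat.le_induction with
  | base => decide
  | succ r hr ih =>
    have h1 : ¬ (2 * r + 2).Prime := fun hp => by
      have := (Nat.prime_dvd_prime_iff_eq Nat.prime_two hp).1 ⟨r + 1, by ring⟩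
      omega
    simp only [Nat.primeCounting, Nat.primeCounting'] at ih ⊢
    rw [show 2 * (r + 1) + 1 = 2 * r + 1 + 1 + 1 by ring, Nat.count_succ, Nat.count_succ,
      if_neg h1]
    split_ifs <;> omega

theorem mul_ascFactorial_le_descFactorial {n q : ℕ} (hq : q * (q + 1) ≤ n) :
    ((n : ℤ) - q * (q + 1)) * (n + 1).ascFactorial q ≤ n.descFactorial (q + 1) := by
  induction q with
  | zero => simp
  | succ q ih =>
    have hq' : q + 1 ≤ n := by nlinarith
    have h1 := ih (by nlinarith)
    rw [Nat.ascFactorial_succ, Nat.descFactorial_succ n (q + 1)]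
    have h2 : (0 : ℤ) ≤ n - (q + 1) := by
      have : ((q + 1 : ℕ) : ℤ) ≤ n := by exact_mod_cast hq'
      push_cast at this
      linarith
    have h3 := mul_le_mul_of_nonneg_left h1 h2
    push_cast [Nat.cast_sub hq']
    refine le_trans ?_ h3
    rw [← mul_assoc, ← mul_assoc]
    refine mul_le_mul_of_nonneg_right ?_ (by positivity)
    nlinarith [sq_nonneg ((q : ℤ) + 1)]

theorem lcmUpTo_mul_choose_lt {n r : ℕ} (hr : 5 ≤ r) (hn : r ^ 3 < n)
    (hn' : r ^ Nat.primeCounting r < n) :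
    lcmUpTo r * (n + r).choose r < n.choose (r + 2) := by
  have hr3 : 5 * r ^ 2 ≤ r ^ 3 := by
    rw [pow_succ' r 2]
    exact Nat.mul_le_mul_right _ hr
  have hrr : 5 * r ≤ r ^ 2 := by
    rw [sq]
    exact Nat.mul_le_mul_right _ hr
  have hr1 : r + 1 ≤ n := by omega
  have h1 := mul_ascFactorial_le_descFactorial (n := n) (q := r) (by nlinarith)
  have h2 : (n : ℤ) * ((r + 1) * (r + 2)) * (n + 1).ascFactorial r ≤
      n.descFactorial (r + 2) := by
    rw [Nat.descFactorial_succ n (r + 1)]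
    have hnr : (0 : ℤ) ≤ n - (r + 1) := by
      have : ((r + 1 : ℕ) : ℤ) ≤ n := by exact_mod_cast hr1
      push_cast at this
      linarith
    have h3 := mul_le_mul_of_nonneg_left h1 hnr
    push_cast [Nat.cast_sub hr1]
    refine le_trans ?_ h3
    rw [← mul_assoc ((n : ℤ) - (r + 1))]
    refine mul_le_mul_of_nonneg_right ?_ (by positivity)
    have h4 : (2 * r ^ 2 + 5 * r + 3 : ℤ) ≤ n := by
      have : 2 * r ^ 2 + 5 * r + 3 ≤ n := by omega
      exact_mod_cast this
    nlinarith [mul_le_mul_of_nonneg_left h4 (Int.natCast_nonneg n),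
      mul_nonneg (Int.natCast_nonneg r) (sq_nonneg ((r : ℤ) + 1))]
  rw [Nat.ascFactorial_eq_factorial_mul_choose, Nat.descFactorial_eq_factorial_mul_choose,
    Nat.factorial_succ, Nat.factorial_succ] at h2
  have h5 : n * (n + r).choose r ≤ n.choose (r + 2) := by
    have h6 : (r + 1 + 1) * ((r + 1) * r.factorial) * (n * (n + r).choose r) ≤
        (r + 1 + 1) * ((r + 1) * r.factorial) * n.choose (r + 2) := by
      zify
      push_cast at h2
      linarith
    exact le_of_mul_le_mul_left h6 (by positivity)
  refine lt_of_lt_of_le ?_ h5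
  exact Nat.mul_lt_mul_of_pos_right ((lcmUpTo_le r).trans_lt hn')
    (Nat.choose_pos (Nat.le_add_left _ _))

theorem mul_choose_lt_choose_succ {A n r : ℕ} (hn : r + 2 ≤ n)
    (h : A * (n + r).choose r < n.choose (r + 2)) :
    A * (n + 1 + r).choose r < (n + 1).choose (r + 2) := by
  obtain ⟨d, rfl⟩ := Nat.exists_eq_add_of_le hn
  have h1 := Nat.choose_mul_succ_eq (r + 2 + d) (r + 2)
  have h2 := Nat.choose_mul_succ_eq (r + 2 + d + r) r
  rw [show r + 2 + d + 1 - (r + 2) = d + 1 by omega] at h1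
  rw [show r + 2 + d + r + 1 - r = r + 2 + d + 1 by omega,
    show r + 2 + d + r + 1 = r + 2 + d + 1 + r by ring] at h2
  refine lt_of_mul_lt_mul_right (a := (r + 2 + d + 1) * (d + 1)) ?_ (Nat.zero_le _)
  calc A * (r + 2 + d + 1 + r).choose r * ((r + 2 + d + 1) * (d + 1))
      = A * (r + 2 + d + r).choose r * ((r + 2 + d + 1 + r) * (d + 1)) := by
        linear_combination (A * (d + 1)) * h2.symm
    _ < (r + 2 + d).choose (r + 2) * ((r + 2 + d + 1 + r) * (d + 1)) :=
        Nat.mul_lt_mul_of_pos_right h (by positivity)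
    _ ≤ (r + 2 + d).choose (r + 2) * ((r + 2 + d + 1) * (r + 2 + d + 1)) :=
        Nat.mul_le_mul_left _ (by nlinarith)
    _ = (r + 2 + d + 1).choose (r + 2) * ((r + 2 + d + 1) * (d + 1)) := by
        linear_combination (r + 2 + d + 1) * h1

theorem lcmUpTo_lt_choose {n r : ℕ} (hr : 5 ≤ r) (hn : r ^ 3 < n) :
    lcmUpTo (2 * r) < n.choose (r + 1) := by
  have hr3 : 5 * r ^ 2 ≤ r ^ 3 := by
    rw [pow_succ' r 2]
    exact Nat.mul_le_mul_right _ hr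
  have hrr : 5 * r ≤ r ^ 2 := by
    rw [sq]
    exact Nat.mul_le_mul_right _ hr
  have h1 : lcmUpTo (2 * r) ≤ (2 * r) ^ r := (lcmUpTo_le _).trans
    (Nat.pow_le_pow_right (by omega) (primeCounting_two_mul_le (by omega)))
  have h2 : 2 * r * (r + 1) ≤ n + 1 - (r + 1) := by
    have : 2 * r * (r + 1) = 2 * r ^ 2 + 2 * r := by ring
    omega
  have h3 := (Nat.pow_le_pow_left h2 (r + 1)).trans (Nat.pow_sub_le_descFactorial n (r + 1))
  rw [Nat.descFactorial_eq_factorial_mul_choose, mul_pow] at h3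
  refine h1.trans_lt (lt_of_mul_lt_mul_right (a := (r + 1) ^ (r + 1)) ?_ (Nat.zero_le _))
  calc (2 * r) ^ r * (r + 1) ^ (r + 1) < (2 * r) ^ (r + 1) * (r + 1) ^ (r + 1) :=
        Nat.mul_lt_mul_of_pos_right (Nat.pow_lt_pow_right (by omega) (by omega)) (by positivity)
    _ ≤ (r + 1).factorial * n.choose (r + 1) := h3
    _ ≤ (r + 1) ^ (r + 1) * n.choose (r + 1) :=
        Nat.mul_le_mul_right _ (Nat.factorial_le_pow _)
    _ = _ := mul_comm _ _

theorem lcmUpTo_mul_choose_lt_of_le {n n₀ r : ℕ} (hn₀ : r + 2 ≤ n₀)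
    (h : lcmUpTo r * (n₀ + r).choose r < n₀.choose (r + 2)) (hn : n₀ ≤ n) :
    lcmUpTo r * (n + r).choose r < n.choose (r + 2) := by
  induction n, hn using Nat.le_induction with
  | base => exact h
  | succ n hn ih => exact mul_choose_lt_choose_succ (hn₀.trans hn) ih

theorem le_pow_primeCounting_of_modLe {n r k : ℕ} (h : ModLe n r k) (hk : 1 ≤ k)
    (hkn : 2 * k ≤ n) : n ≤ r ^ Nat.primeCounting r := by
  rcases Nat.lt_or_ge r k with hrk | hrk
  swap
  · exact le_pow_primeCounting_of_le h hk (by omega) hrk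
  by_contra! hn
  have hdvd := h.choose_dvd (by omega)
  have hle : ∀ a ≤ k, n.choose a ≤ n.choose k := fun a ha => choose_le_choose_of_le_half ha hkn
  have hlt : ¬ lcmUpTo r * (n + r).choose r < n.choose k :=
    (Nat.le_of_dvd (Nat.mul_pos (Nat.pos_of_ne_zero (lcmUpTo_ne_zero r))
      (Nat.choose_pos (Nat.le_add_left _ _))) hdvd).not_gt
  have hlt' : ∀ n₀ ≤ n, r + 2 ≤ n₀ → lcmUpTo r * (n₀ + r).choose r < n₀.choose (r + 2) →
      k ≤ r + 1 := by
    intro n₀ hn₀ hr₀ h₀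
    by_contra! hkr
    exact hlt ((lcmUpTo_mul_choose_lt_of_le hr₀ h₀ hn₀).trans_le (hle _ hkr))
  have hadj : 1 ≤ r → k = r + 1 → n.choose (r + 1) ≤ lcmUpTo (2 * r) := by
    rintro hr rfl
    have := Nat.le_of_dvd (Nat.pos_of_ne_zero (lcmUpTo_ne_zero _))
      (h.choose_dvd_lcmUpTo hr (by omega))
    rwa [show r + 1 + r - 1 = 2 * r by omega] at this
  rcases Nat.lt_or_ge r 5 with hr | hr
  · have h2 := show Nat.primeCounting 2 = 1 by decide
    have h3 := show Nat.primeCounting 3 = 2 by decide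
    have h4 := show Nat.primeCounting 4 = 2 by decide
    interval_cases r
    · have h5 := hle 1 hk
      have h6 := Nat.le_of_dvd one_pos
        (show n.choose k ∣ 1 by simpa [show lcmUpTo 0 = 1 by decide] using hdvd)
      rw [Nat.choose_one_right] at h5
      omega
    · have h5 : k ≠ 2 := fun hk' => by
        have h6 := hadj le_rfl hk'
        have h7 := Nat.choose_le_choose 2 (show 4 ≤ n by omega)
        rw [show lcmUpTo (2 * 1) = 2 by decide] at h6
        rw [show Nat.choose 4 2 = 6 by decide] at h7
        exact absurd (h7.trans h6) (by norm_num)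
      have := hlt' 6 (by omega) (by norm_num) (by decide)
      omega
    · rw [h2] at hn
      have h5 : k ≠ 3 := fun hk' => by
        have h6 := hadj (by omega) hk'
        have h7 := Nat.choose_le_choose 3 (show 6 ≤ n by omega)
        rw [show lcmUpTo 4 = 12 by decide +kernel] at h6
        rw [show Nat.choose 6 3 = 20 by decide] at h7
        exact absurd (h7.trans h6) (by norm_num)
      have h6 : n < 9 := by
        by_contra! h6
        have := hlt' 9 h6 (by norm_num) (by decide +kernel)
        omega
      have h7 : k ≤ 4 := by omega
      rw [show lcmUpTo 2 = 2 by decide] at hdvd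
      clear hlt hlt' hadj h hle
      interval_cases n <;> interval_cases k <;> first | omega | (norm_num [Nat.choose] at hdvd)
    · rw [h3] at hn
      have h5 : k ≠ 4 := fun hk' => by
        have h6 := hadj (by omega) hk'
        have h7 := Nat.choose_le_choose 4 (show 10 ≤ n by omega)
        rw [show lcmUpTo 6 = 60 by decide +kernel] at h6
        rw [show Nat.choose 10 4 = 210 by decide] at h7
        exact absurd (h7.trans h6) (by norm_num)
      have h6 : n < 18 := by
        by_contra! h6
        have := hlt' 18 h6 (by norm_num) (by decide +kernel)
        omega
      have h7 : k ≤ 8 := by omega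
      rw [show lcmUpTo 3 = 6 by decide] at hdvd
      clear hlt hlt' hadj h hle
      interval_cases n <;> interval_cases k <;> first | omega | (norm_num [Nat.choose] at hdvd)
    · rw [h4] at hn
      have h5 : k ≠ 5 := fun hk' => by
        have h6 := hadj (by omega) hk'
        have h7 := Nat.choose_le_choose 5 (show 17 ≤ n by omega)
        rw [show lcmUpTo 8 = 840 by decide +kernel] at h6
        rw [show Nat.choose 17 5 = 6188 by decide] at h7
        exact absurd (h7.trans h6) (by norm_num)
      have h6 : n < 30 := by
        by_contra! h6
        have := hlt' 30 h6 (by norm_num) (by decide +kernel)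
        omega
      have h7 : k ≤ 14 := by omega
      rw [show lcmUpTo 4 = 12 by decide] at hdvd
      clear hlt hlt' hadj h hle
      interval_cases n <;> interval_cases k <;> first | omega | (norm_num [Nat.choose] at hdvd)
  · have hn3 : r ^ 3 < n := by
      refine lt_of_le_of_lt (Nat.pow_le_pow_right (by omega) ?_) hn
      exact (show 3 ≤ Nat.primeCounting 5 by decide).trans (Nat.monotone_primeCounting hr)
    have h1 := lcmUpTo_lt_choose hr hn3
    have h2 := lcmUpTo_mul_choose_lt hr hn3 hn
    rcases Nat.lt_or_ge (r + 1) k with hk2 | hk2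
    · exact hlt (h2.trans_le (hle _ hk2))
    · exact (hadj (by omega) (by omega)).not_gt h1

theorem laguerre_reducible_bound (n r : ℕ) (hn : 1 ≤ n)
    (h : ∃ g : Polynomial ℚ, g.Monic ∧ g ∣ laguerreL n r ∧
          1 ≤ g.natDegree ∧ 2 * g.natDegree ≤ n) :
    n ≤ r ^ (Nat.primeCounting r) := by
  obtain ⟨g, -, hg, hk, hkn⟩ := h
  refine le_pow_primeCounting_of_modLe (fun p m hp hr => ?_) hk hkn
  have := Fact.mk hp
  exact natDegree_mod_le_of_dvd_laguerreL hr hg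
end
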